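/- Let N ≥ 2 be an integer, p a real with 1 < p < N and α > 0 with α ≠ α(k) for every integer k ≥ 2. Suppose v : ℝ^N → ℝ is continuous on ℝ^N, continuously differentiable on ℝ^N∖{0}, satisfies ∫_{ℝ^N}|∇v|^p dx < ∞, and is a weak solution of the linearized equation at U_α: for every φ ∈ C_c^∞(ℝ^N), ∫_{ℝ^N} [ |∇U_α|^{p−2} ∇v·∇φ + (p−2)|∇U_α|^{p−4}(∇U_α·∇v)(∇U_α·∇φ) ] dx = (p*_α−1) ∫_{ℝ^N} |x|^α U_α(x)^{p*_α−2} v(x) φ(x) dx, all integrals being absolutely convergent. Then there exists c ∈ ℝ such that v(x) = c · ((p−1) − |x|^{(p+α)/(p−1)}) (1 + |x|^{(p+α)/(p−1)})^{−(N+α)/(p+α)} for all x ∈ ℝ^N. (Non-degeneracy of U_α: for α > 0 different from all α(k), the kernel of the linearized operator is one-dimensional and spanned by Z.) -/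

import Mathlib

open MeasureTheory Real
open scoped RealInnerProductSpace

noncomputable section

/-- The critical Hénon exponent `p*_α = p(N+α)/(N-p)`. -/
def pS (N p α : ℝ) : ℝ := p * (N + α) / (N - p)

/-- The normalizing constant `C_{N,p,α}`. -/
def Cnpa (N p α : ℝ) : ℝ :=
  ((N + α) * ((N - p) / (p - 1)) ^ (p - 1)) ^ ((N - p) / (p * (p + α)))

/-- The radial profile `U_α(r)` of the standard solution. -/
def Urad (N p α r : ℝ) : ℝ :=
  Cnpa N p α * (1 + r ^ ((p + α) / (p - 1))) ^ (-((N - p) / (p + α)))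

/-- The standard solution `U_α` on `ℝ^N`. -/
def Ufun (N : ℕ) (p α : ℝ) (x : EuclideanSpace ℝ (Fin N)) : ℝ := Urad N p α ‖x‖

/-- The bifurcation values `α(k)`. -/
def alphaK (N p : ℝ) (k : ℕ) : ℝ :=
  (p * Real.sqrt ((N + p - 2) ^ 2 + 4 * ((k : ℝ) - 1) * (p - 1) * ((k : ℝ) + N - 1))
      - p * (N + p - 2)) / (2 * (p - 1))

/-- A continuous function on the half-line that annihilates all test functions vanishes. -/
theorem eq_zero_of_forall_integral_test_mul {f : ℝ → ℝ} (hf : ContinuousOn f (Set.Ioi 0))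
    (h : ∀ ρ : ℝ → ℝ, ContDiff ℝ (⊤ : ℕ∞) ρ → HasCompactSupport ρ → tsupport ρ ⊆ Set.Ioi 0 →
      ∫ r, ρ r * f r = 0) : ∀ r, 0 < r → f r = 0 := by
  have h1 := isOpen_Ioi.ae_eq_zero_of_integral_contDiff_smul_eq_zero (μ := volume)
    (hf.locallyIntegrableOn measurableSet_Ioi)
    (fun g hg hc hs => by simpa using h g hg hc hs)
  have h2 : f =ᵐ[volume.restrict (Set.Ioi 0)] fun _ => (0 : ℝ) := by
    rw [Filter.EventuallyEq, ae_restrict_iff' measurableSet_Ioi]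
    exact h1
  exact fun r hr => Measure.eqOn_open_of_ae_eq h2 isOpen_Ioi hf continuousOn_const hr

/-- The compactly supported (to the right) primitive of a test function. -/
theorem exists_primitive_of_test {ρ : ℝ → ℝ} (hρ : ContDiff ℝ (⊤ : ℕ∞) ρ)
    (hc : HasCompactSupport ρ) (hs : tsupport ρ ⊆ Set.Ioi 0) :
    ∃ (η : ℝ → ℝ) (a R : ℝ), 0 < a ∧ a < R ∧ ContDiff ℝ (⊤ : ℕ∞) η ∧ deriv η = ρ ∧
      (∀ x ≤ a, η x = -∫ r, ρ r) ∧ ∀ x, R ≤ x → η x = 0 := by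
  obtain ⟨a, R, ha, haR, hsub⟩ : ∃ a R : ℝ, 0 < a ∧ a < R ∧ tsupport ρ ⊆ Set.Ioc a R := by
    rcases (tsupport ρ).eq_empty_or_nonempty with he | hne
    · exact ⟨1, 2, one_pos, one_lt_two, by simp [he]⟩
    · obtain ⟨x, hx, hmin⟩ := hc.isCompact.exists_isMinOn hne continuousOn_id
      obtain ⟨y, hy, hmax⟩ := hc.isCompact.exists_isMaxOn hne continuousOn_id
      have hx0 : (0 : ℝ) < x := hs hx
      refine ⟨x / 2, y, by positivity, ?_, fun z hz => ⟨?_, hmax hz⟩⟩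
      · have : x ≤ y := hmin hy
        linarith
      · have : x ≤ z := hmin hz
        linarith
  have hcont : Continuous ρ := hρ.continuous
  have hd : ∀ x, HasDerivAt (fun x => ∫ t in R..x, ρ t) (ρ x) x := fun x =>
    intervalIntegral.integral_hasDerivAt_right (hcont.intervalIntegrable _ _)
      hcont.aestronglyMeasurable.stronglyMeasurableAtFilter hcont.continuousAt
  have hde : deriv (fun x => ∫ t in R..x, ρ t) = ρ := funext fun x => (hd x).deriv
  refine ⟨fun x => ∫ t in R..x, ρ t, a, R, ha, haR, ?_, hde, ?_, ?_⟩
  · have : ContDiff ℝ ((⊤ : ℕ∞) + 1) (fun x => ∫ t in R..x, ρ t) := by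
      rw [contDiff_succ_iff_deriv]
      refine ⟨fun x => (hd x).differentiableAt, by simp, by rw [hde]; exact hρ⟩
    exact this.of_le (by simp)
  · intro x hx
    change ∫ t in R..x, ρ t = _
    rw [intervalIntegral.integral_symm,
      intervalIntegral.integral_eq_integral_of_support_subset]
    exact (subset_tsupport ρ).trans (hsub.trans (Set.Ioc_subset_Ioc_left hx))
  · intro x hx
    refine intervalIntegral.integral_zero_ae (Filter.Eventually.of_forall fun t ht => ?_)
    rw [Set.uIoc_of_le hx] at ht
    by_contra h0
    exact absurd (hsub (subset_tsupport ρ h0)).2 (not_le.2 ht.1)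

/-- The fundamental lemma of du Bois-Reymond on the half-line, with a lower order term. -/
theorem hasDerivAt_of_forall_integral_test {f g : ℝ → ℝ} (hf : ContinuousOn f (Set.Ioi 0))
    (hg : ContinuousOn g (Set.Ioi 0))
    (h : ∀ η : ℝ → ℝ, ContDiff ℝ (⊤ : ℕ∞) η → HasCompactSupport η → tsupport η ⊆ Set.Ioi 0 →
      ∫ r, (deriv η r * f r + η r * g r) = 0) : ∀ r, 0 < r → HasDerivAt f (g r) r := by
  set G : ℝ → ℝ := fun x => ∫ t in (1 : ℝ)..x, g t with hG
  have hGd : ∀ x, 0 < x → HasDerivAt G (g x) x := fun x hx => by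
    refine intervalIntegral.integral_hasDerivAt_right ?_ ?_ (hg.continuousAt (Ioi_mem_nhds hx))
    · refine (hg.mono ?_).intervalIntegrable
      intro y hy
      exact lt_of_lt_of_le (lt_min one_pos hx) hy.1
    · exact hg.stronglyMeasurableAtFilter isOpen_Ioi x hx
  have hGc : ContinuousOn G (Set.Ioi 0) := fun x hx =>
    (hGd x hx).continuousAt.continuousWithinAt
  have hinteg : ∀ {ρ F : ℝ → ℝ}, Continuous ρ → HasCompactSupport ρ → tsupport ρ ⊆ Set.Ioi 0 →
      ContinuousOn F (Set.Ioi 0) → Integrable (fun r => ρ r * F r) := by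
    intro ρ F hρ hc hs hF
    have h1 : Continuous (fun r => ρ r * F r) := by
      rw [continuous_iff_continuousAt]
      intro x
      by_cases hx : x ∈ tsupport ρ
      · exact hρ.continuousAt.mul (hF.continuousAt (Ioi_mem_nhds (hs hx)))
      · have : (fun r => ρ r * F r) =ᶠ[nhds x] fun _ => 0 := by
          filter_upwards [(isClosed_tsupport ρ).isOpen_compl.mem_nhds hx] with y hy
          simp [image_eq_zero_of_notMem_tsupport hy]
        exact continuousAt_const.congr this.symm
    exact h1.integrable_of_hasCompactSupport hc.mul_right
  have hkey : ∀ η : ℝ → ℝ, ContDiff ℝ (⊤ : ℕ∞) η → HasCompactSupport η →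
      tsupport η ⊆ Set.Ioi 0 → ∫ r, deriv η r * (f r - G r) = 0 := by
    intro η hη hc hs
    have hs' : tsupport (deriv η) ⊆ Set.Ioi 0 := fun x hx => hs (tsupport_deriv_subset hx)
    have hcd : Continuous (deriv η) := hη.continuous_deriv (by simp)
    have i1 := hinteg hcd hc.deriv hs' hf
    have i2 := hinteg hcd hc.deriv hs' hGc
    have i3 := hinteg hη.continuous hc hs hg
    have i4 := hinteg hη.continuous hc hs hGc
    have hibp : ∫ r, G r * deriv η r = -∫ r, g r * η r := by
      have := integral_bilinear_hasLineDerivAt_right_eq_neg_left_of_integrable (μ := volume)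
        (f := G) (f' := g) (g := η) (g' := deriv η) (v := (1 : ℝ))
        (B := ContinuousLinearMap.mul ℝ ℝ)
        (by simpa [mul_comm] using i3) (by simpa [mul_comm] using i2)
        (by simpa [mul_comm] using i4)
        (fun x hx => by
          simpa using (hGd x (hs hx)).hasFDerivAt.hasLineDerivAt 1)
        (fun x _ => by
          simpa using (hη.differentiable (by simp) x).hasDerivAt.hasFDerivAt.hasLineDerivAt 1)
      simpa using this
    have h0 := h η hη hc hs
    rw [integral_add i1 i3] at h0
    simp_rw [mul_sub]
    rw [integral_sub i1 i2]
    have e1 : ∫ r, deriv η r * G r = ∫ r, G r * deriv η r := by simp_rw [mul_comm]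
    have e2 : ∫ r, g r * η r = ∫ r, η r * g r := by simp_rw [mul_comm]
    rw [e1, hibp, e2]; linarith
  obtain ⟨ρ₀, h0d, h0c, h0s, h0i⟩ : ∃ ρ : ℝ → ℝ, ContDiff ℝ (⊤ : ℕ∞) ρ ∧ HasCompactSupport ρ ∧
      tsupport ρ ⊆ Set.Ioi 0 ∧ ∫ r, ρ r = 1 := by
    let b : ContDiffBump (2 : ℝ) := ⟨1 / 2, 1, by norm_num, by norm_num⟩
    refine ⟨b.normed volume, b.contDiff_normed, b.hasCompactSupport_normed, ?_, b.integral_normed⟩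
    rw [b.tsupport_normed_eq, Real.closedBall_eq_Icc]
    intro x hx
    have : (1 : ℝ) ≤ x := by have := hx.1; change (2 : ℝ) - 1 ≤ x at this; linarith
    exact lt_of_lt_of_le one_pos this
  set K := ∫ r, ρ₀ r * (f r - G r) with hK
  have hFc : ContinuousOn (fun r => f r - G r) (Set.Ioi 0) := hf.sub hGc
  have hz : ∀ r, 0 < r → (f r - G r) - K = 0 := by
    apply eq_zero_of_forall_integral_test_mul (hFc.sub continuousOn_const)
    intro ρ hρ hc hs
    set c := ∫ r, ρ r with hcdef
    set τ : ℝ → ℝ := fun r => ρ r - c * ρ₀ r with hτ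
    have iρ : Integrable ρ := hρ.continuous.integrable_of_hasCompactSupport hc
    have iρ₀ : Integrable ρ₀ := h0d.continuous.integrable_of_hasCompactSupport h0c
    have hτs : tsupport τ ⊆ Set.Ioi 0 := by
      have : tsupport τ ⊆ tsupport ρ ∪ tsupport ρ₀ := by
        refine closure_minimal ?_ ((isClosed_tsupport _).union (isClosed_tsupport _))
        intro x hx
        by_contra hn
        rw [Set.mem_union, not_or] at hn
        apply hx
        simp [hτ, image_eq_zero_of_notMem_tsupport hn.1, image_eq_zero_of_notMem_tsupport hn.2]
      exact this.trans (Set.union_subset hs h0s)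
    have hτc : HasCompactSupport τ := hc.sub (h0c.mul_left (f := fun _ => c))
    have hτd : ContDiff ℝ (⊤ : ℕ∞) τ := hρ.sub (contDiff_const.mul h0d)
    have hτi : ∫ r, τ r = 0 := by
      rw [hτ, integral_sub iρ (iρ₀.const_mul c), integral_const_mul, h0i]
      simp [hcdef]
    obtain ⟨η, a, R, ha, haR, hηd, hηd', hηa, hηR⟩ := exists_primitive_of_test hτd hτc hτs
    rw [hτi, neg_zero] at hηa
    have hηsub : tsupport η ⊆ Set.Icc a R := by
      refine closure_minimal (fun x hx => ?_) isClosed_Icc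
      constructor
      · by_contra hn; exact hx (hηa x (by linarith))
      · by_contra hn; exact hx (hηR x (by linarith))
    have h1 := hkey η hηd
      (isCompact_Icc.of_isClosed_subset (isClosed_tsupport η) hηsub)
      (hηsub.trans fun x hx => lt_of_lt_of_le ha hx.1)
    rw [hηd'] at h1
    have i1 := hinteg hρ.continuous hc hs hFc
    have i2 := hinteg h0d.continuous h0c h0s hFc
    have : ∫ r, τ r * (f r - G r) = (∫ r, ρ r * (f r - G r)) - c * K := by
      rw [hK, ← integral_const_mul, ← integral_sub i1 (i2.const_mul c)]
      congr 1; funext r; simp only [hτ]; ring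
    have e : ∀ r, ρ r * (f r - G r - K) = ρ r * (f r - G r) - ρ r * K := fun r => by ring
    change ∫ r, ρ r * (f r - G r - K) = 0
    simp_rw [e]
    rw [integral_sub i1 (iρ.mul_const K), integral_mul_const]
    linarith
  intro r hr
  have : (fun x => G x + K) =ᶠ[nhds r] f := by
    filter_upwards [Ioi_mem_nhds hr] with x hx
    have := hz x hx
    linarith
  exact ((hGd r hr).add_const K).congr_of_eventuallyEq this.symm

section Polar

variable {E : Type*} [NormedAddCommGroup E] [InnerProductSpace ℝ E] [FiniteDimensional ℝ E]
  [Nontrivial E] [MeasurableSpace E] [BorelSpace E] (μ : Measure E) [μ.IsAddHaarMeasure]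

/-- Integration in polar coordinates. -/
theorem integral_polar {f : E → ℝ} (hf : Integrable f μ) :
    IntegrableOn (fun r : ℝ => r ^ (Module.finrank ℝ E - 1) *
      ∫ ω : Metric.sphere (0 : E) 1, f (r • (ω : E)) ∂μ.toSphere) (Set.Ioi 0) ∧
    ∫ x, f x ∂μ = ∫ r in Set.Ioi (0 : ℝ), r ^ (Module.finrank ℝ E - 1) *
      ∫ ω : Metric.sphere (0 : E) 1, f (r • (ω : E)) ∂μ.toSphere := by
  set n := Module.finrank ℝ E - 1 with hn
  have hmp := μ.measurePreserving_homeomorphUnitSphereProd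
  have hemb := (homeomorphUnitSphereProd E).measurableEmbedding
  set g : Metric.sphere (0 : E) 1 × Set.Ioi (0 : ℝ) → ℝ := fun p => f (p.2.1 • (p.1 : E)) with hg
  have hgf : ∀ x : ({0}ᶜ : Set E), g (homeomorphUnitSphereProd E x) = f x := by
    intro x
    have hx : ‖(x : E)‖ ≠ 0 := norm_ne_zero_iff.2 x.2
    simp [hg, smul_smul, hx]
  have hi : Integrable g (μ.toSphere.prod (.volumeIoiPow n)) := by
    rw [← hmp.integrable_comp_emb hemb]
    have : g ∘ (homeomorphUnitSphereProd E) = f ∘ Subtype.val := funext hgf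
    rw [this, ← integrableOn_iff_comap_subtypeVal (measurableSet_singleton _).compl]
    exact hf.integrableOn
  have hii := hi.integral_prod_right
  have e1 : ∫ x, f x ∂μ = ∫ r : Set.Ioi (0 : ℝ), ∫ ω, g (ω, r) ∂μ.toSphere ∂(.volumeIoiPow n) := by
    rw [← integral_prod_symm _ hi, ← hmp.integral_comp hemb]
    simp_rw [hgf]
    rw [integral_subtype_comap (measurableSet_singleton _).compl, restrict_compl_singleton]
  set G : ℝ → ℝ := fun r => ∫ ω : Metric.sphere (0 : E) 1, f (r • (ω : E)) ∂μ.toSphere with hG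
  have hGg : ∀ r : Set.Ioi (0 : ℝ), ∫ ω, g (ω, r) ∂μ.toSphere = G r := fun r => rfl
  simp_rw [hGg] at hii e1
  constructor
  · rw [integrableOn_iff_comap_subtypeVal measurableSet_Ioi]
    rw [Measure.volumeIoiPow, integrable_withDensity_iff_integrable_smul'] at hii
    · refine hii.congr (.of_forall ?_)
      rintro ⟨r, hr : 0 < r⟩
      simp [ENNReal.toReal_ofReal (pow_nonneg hr.le n), hG]
    · fun_prop
    · simp
  · rw [e1]
    simp only [Measure.volumeIoiPow, ENNReal.ofReal]
    rw [integral_withDensity_eq_integral_smul,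
      integral_subtype_comap measurableSet_Ioi fun a ↦ Real.toNNReal (a ^ n) • G a,
      setIntegral_congr_fun measurableSet_Ioi fun x hx ↦ ?_]
    · rw [NNReal.smul_def, Real.coe_toNNReal _ (pow_nonneg hx.out.le _), smul_eq_mul]
    · exact (measurable_subtype_coe.pow_const _).real_toNNReal

/-- The moment of `F` over the sphere of radius `r` against the `k`-th power of `⟪ξ, ·⟫`. -/
def sphereMoment (F : E → ℝ) (ξ : E) (k : ℕ) (r : ℝ) : ℝ :=
  ∫ ω : Metric.sphere (0 : E) 1, F (r • (ω : E)) * ⟪ξ, (ω : E)⟫ ^ k ∂μ.toSphere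

/-- The derivative of `F` in the direction `x / ‖x‖`. -/
def radialDeriv (F : E → ℝ) (x : E) : ℝ := fderiv ℝ F x x / ‖x‖

variable {μ}

omit [Nontrivial E] in
theorem continuousOn_sphereMoment {F : E → ℝ} (hF : ContinuousOn F {x | x ≠ 0}) (ξ : E) (k : ℕ) :
    ContinuousOn (sphereMoment μ F ξ k) (Set.Ioi 0) := by
  rw [continuousOn_iff_continuous_domRestrict]
  have : LocallyCompactSpace (Set.Ioi (0 : ℝ)) := isOpen_Ioi.locallyCompactSpace
  have hsm : Continuous fun p : Set.Ioi (0 : ℝ) × Metric.sphere (0 : E) 1 =>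
      (p.1 : ℝ) • (p.2 : E) := by fun_prop
  have h := continuous_parametric_integral_of_continuous (μ := μ.toSphere)
    (f := fun (r : Set.Ioi (0 : ℝ)) (ω : Metric.sphere (0 : E) 1) =>
      F ((r : ℝ) • (ω : E)) * ⟪ξ, (ω : E)⟫ ^ k) (s := Set.univ)
    (by
      refine (hF.comp_continuous hsm fun p => ?_).mul (by fun_prop)
      exact smul_ne_zero p.1.2.ne' (ne_zero_of_mem_unit_sphere p.2)) isCompact_univ
  simpa [sphereMoment, Set.domRestrict_def] using h

omit [Nontrivial E] in
theorem continuous_sphereMoment {F : E → ℝ} (hF : Continuous F) (ξ : E) (k : ℕ) :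
    Continuous (sphereMoment μ F ξ k) := by
  have h := continuous_parametric_integral_of_continuous (μ := μ.toSphere)
    (f := fun (r : ℝ) (ω : Metric.sphere (0 : E) 1) =>
      F ((r : ℝ) • (ω : E)) * ⟪ξ, (ω : E)⟫ ^ k) (s := Set.univ)
    (by fun_prop) isCompact_univ
  simp only [Measure.restrict_univ] at h
  exact h

omit [InnerProductSpace ℝ E] [FiniteDimensional ℝ E] [Nontrivial E] [MeasurableSpace E]
  [BorelSpace E] in
theorem isOpen_ne_zero : IsOpen {x : E | x ≠ 0} := isOpen_ne

omit [FiniteDimensional ℝ E] [Nontrivial E] [MeasurableSpace E] [BorelSpace E] in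
theorem continuousOn_radialDeriv {F : E → ℝ} (hF : ContDiffOn ℝ 1 F {x | x ≠ 0}) :
    ContinuousOn (radialDeriv F) {x | x ≠ 0} := by
  have h := hF.continuousOn_fderiv_of_isOpen isOpen_ne_zero le_rfl
  exact (h.clm_apply continuousOn_id).div continuous_norm.continuousOn
    fun x hx => norm_ne_zero_iff.2 hx

omit [FiniteDimensional ℝ E] [Nontrivial E] [MeasurableSpace E] [BorelSpace E] in
theorem hasDerivAt_comp_smul_sphere {F : E → ℝ} (hF : ContDiffOn ℝ 1 F {x | x ≠ 0})
    (ω : Metric.sphere (0 : E) 1) {r : ℝ} (hr : 0 < r) :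
    HasDerivAt (fun r : ℝ => F (r • (ω : E))) (radialDeriv F (r • (ω : E))) r := by
  have h0 : r • (ω : E) ≠ 0 := smul_ne_zero hr.ne' (ne_zero_of_mem_unit_sphere ω)
  have hd := ((hF.contDiffAt (isOpen_ne_zero.mem_nhds h0)).differentiableAt one_ne_zero).hasFDerivAt
  have h1 : HasDerivAt (fun r : ℝ => r • (ω : E)) (ω : E) r := by
    simpa using (hasDerivAt_id r).smul_const (ω : E)
  have h2 := hd.comp_hasDerivAt r h1
  have e : radialDeriv F (r • (ω : E)) = fderiv ℝ F (r • (ω : E)) (ω : E) := by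
    rw [radialDeriv, norm_smul, norm_eq_of_mem_sphere, mul_one, Real.norm_of_nonneg hr.le, map_smul,
      smul_eq_mul, mul_div_cancel_left₀ _ hr.ne']
  rw [e]
  exact h2

omit [Nontrivial E] in
theorem hasDerivAt_sphereMoment {F : E → ℝ} (hF : ContDiffOn ℝ 1 F {x | x ≠ 0}) (ξ : E) (k : ℕ)
    {r : ℝ} (hr : 0 < r) :
    HasDerivAt (sphereMoment μ F ξ k) (sphereMoment μ (radialDeriv F) ξ k r) r := by
  have hne : ∀ (r : ℝ), 0 < r → ∀ ω : Metric.sphere (0 : E) 1, r • (ω : E) ≠ 0 := fun r hr ω =>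
    smul_ne_zero hr.ne' (ne_zero_of_mem_unit_sphere ω)
  have hc : ∀ {G : E → ℝ}, ContinuousOn G {x | x ≠ 0} → ∀ r : ℝ, 0 < r →
      Continuous fun ω : Metric.sphere (0 : E) 1 => G (r • (ω : E)) * ⟪ξ, (ω : E)⟫ ^ k :=
    fun hG r hr => (hG.comp_continuous (by fun_prop) (hne r hr)).mul (by fun_prop)
  have hR := continuousOn_radialDeriv hF
  obtain ⟨M, hM⟩ : ∃ M : ℝ, ∀ p ∈ (Set.Icc (r / 2) (2 * r)) ×ˢ
      (Set.univ : Set (Metric.sphere (0 : E) 1)),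
      ‖radialDeriv F (p.1 • (p.2 : E)) * ⟪ξ, (p.2 : E)⟫ ^ k‖ ≤ M := by
    refine (isCompact_Icc.prod isCompact_univ).exists_bound_of_continuousOn ?_
    refine (hR.comp (Continuous.continuousOn (by fun_prop)) ?_).mul
      (Continuous.continuousOn (by fun_prop))
    rintro ⟨s, ω⟩ ⟨hs, -⟩
    exact hne s (lt_of_lt_of_le (half_pos hr) hs.1) ω
  refine (hasDerivAt_integral_of_dominated_loc_of_deriv_le (μ := μ.toSphere)
    (F := fun r (ω : Metric.sphere (0 : E) 1) => F (r • (ω : E)) * ⟪ξ, (ω : E)⟫ ^ k)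
    (bound := fun _ => M)
    (F' := fun r ω => radialDeriv F (r • (ω : E)) * ⟪ξ, (ω : E)⟫ ^ k)
    (s := Set.Icc (r / 2) (2 * r)) (x₀ := r)
    (Icc_mem_nhds (by linarith) (by linarith))
    ?_ ?_ ?_ ?_ (integrable_const M) ?_).2
  · filter_upwards [Ioi_mem_nhds hr] with s hs
    exact (hc hF.continuousOn s hs).aestronglyMeasurable
  · exact (hc hF.continuousOn r hr).integrable_of_hasCompactSupport
      (HasCompactSupport.of_compactSpace _)
  · exact (hc hR r hr).aestronglyMeasurable
  · exact .of_forall fun ω s hs => hM (s, ω) ⟨hs, trivial⟩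
  · refine .of_forall fun ω s hs => ?_
    exact (hasDerivAt_comp_smul_sphere hF ω (lt_of_lt_of_le (half_pos hr) hs.1)).mul_const _

/-- Polar coordinates for a radial factor times a function times a power of a linear form. -/
theorem integral_radial_mul_moment {χ : ℝ → ℝ} {F : E → ℝ} {ξ : E} {k : ℕ}
    (h : Integrable (fun x => χ ‖x‖ * (F x * ⟪ξ, x⟫ ^ k)) μ) :
    IntegrableOn (fun r => r ^ (Module.finrank ℝ E - 1) * (χ r * (r ^ k * sphereMoment μ F ξ k r)))
      (Set.Ioi 0) ∧
    ∫ x, χ ‖x‖ * (F x * ⟪ξ, x⟫ ^ k) ∂μ = ∫ r in Set.Ioi (0 : ℝ),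
      r ^ (Module.finrank ℝ E - 1) * (χ r * (r ^ k * sphereMoment μ F ξ k r)) := by
  have hp := integral_polar μ h
  have e : ∀ r ∈ Set.Ioi (0 : ℝ), r ^ (Module.finrank ℝ E - 1) *
      (∫ ω : Metric.sphere (0 : E) 1, χ ‖r • (ω : E)‖ * (F (r • (ω : E)) * ⟪ξ, r • (ω : E)⟫ ^ k)
        ∂μ.toSphere) =
      r ^ (Module.finrank ℝ E - 1) * (χ r * (r ^ k * sphereMoment μ F ξ k r)) := by
    intro r hr
    congr 1
    rw [sphereMoment, ← integral_const_mul, ← integral_const_mul]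
    congr 1
    funext ω
    rw [norm_smul, norm_eq_of_mem_sphere, mul_one, Real.norm_of_nonneg (le_of_lt hr),
      real_inner_smul_right, mul_pow]
    ring
  refine ⟨hp.1.congr_fun e measurableSet_Ioi,
    hp.2.trans (setIntegral_congr_fun measurableSet_Ioi e)⟩

omit [Nontrivial E] [MeasurableSpace E] [BorelSpace E] in
theorem continuous_radial_mul {χ : ℝ → ℝ} {H : E → ℝ} {a R : ℝ} (ha : 0 < a)
    (hχ : ContinuousOn χ (Set.Ioi 0)) (hz : ∀ r ∉ Set.Icc a R, χ r = 0)
    (hH : ContinuousOn H {x | x ≠ 0}) :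
    Continuous (fun x => χ ‖x‖ * H x) ∧ HasCompactSupport fun x => χ ‖x‖ * H x := by
  constructor
  · rw [continuous_iff_continuousAt]
    intro x
    by_cases hx : x = 0
    · have : (fun x => χ ‖x‖ * H x) =ᶠ[nhds x] fun _ => 0 := by
        filter_upwards [Metric.ball_mem_nhds x ha] with y hy
        rw [hx, mem_ball_zero_iff] at hy
        rw [hz ‖y‖ fun h => absurd h.1 (not_le.2 hy), zero_mul]
      exact continuousAt_const.congr this.symm
    · refine ContinuousAt.mul ?_ (hH.continuousAt (isOpen_ne_zero.mem_nhds hx))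
      exact ContinuousAt.comp (f := fun x : E => ‖x‖)
        (hχ.continuousAt (Ioi_mem_nhds (norm_pos_iff.2 hx))) continuous_norm.continuousAt
  · refine HasCompactSupport.intro (isCompact_closedBall (0 : E) R) fun x hx => ?_
    rw [mem_closedBall_zero_iff] at hx
    rw [hz ‖x‖ fun h => hx h.2, zero_mul]

omit [Nontrivial E] in
theorem integrable_radial_mul {χ : ℝ → ℝ} {H : E → ℝ} {a R : ℝ} (ha : 0 < a)
    (hχ : ContinuousOn χ (Set.Ioi 0)) (hz : ∀ r ∉ Set.Icc a R, χ r = 0)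
    (hH : ContinuousOn H {x | x ≠ 0}) : Integrable (fun x => χ ‖x‖ * H x) μ :=
  have h := continuous_radial_mul ha hχ hz hH
  h.1.integrable_of_hasCompactSupport h.2

end Polar

section WeakForm

variable {E : Type*} [NormedAddCommGroup E] [InnerProductSpace ℝ E]

theorem hasFDerivAt_norm_of_ne_zero {x : E} (hx : x ≠ 0) :
    HasFDerivAt (fun x : E => ‖x‖) (‖x‖⁻¹ • innerSL ℝ x) x := by
  have h := (hasStrictFDerivAt_norm_sq x).hasFDerivAt.sqrt (pow_ne_zero 2 (norm_ne_zero_iff.2 hx))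
  simp only [Real.sqrt_sq (norm_nonneg _)] at h
  convert h using 1
  ext y
  have : ‖x‖ ≠ 0 := norm_ne_zero_iff.2 hx
  simp
  field_simp

theorem hasFDerivAt_radial {χ : ℝ → ℝ} {x : E} (hx : x ≠ 0)
    (hχ : DifferentiableAt ℝ χ ‖x‖) :
    HasFDerivAt (fun x : E => χ ‖x‖) ((deriv χ ‖x‖ * ‖x‖⁻¹) • innerSL ℝ x) x := by
  have h := hχ.hasDerivAt.comp_hasFDerivAt x (hasFDerivAt_norm_of_ne_zero hx)
  rw [smul_smul] at h
  exact h

theorem hasFDerivAt_inner_pow (ξ : E) (k : ℕ) (x : E) :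
    HasFDerivAt (fun x : E => ⟪ξ, x⟫ ^ k) ((k * ⟪ξ, x⟫ ^ (k - 1)) • innerSL ℝ ξ) x := by
  have h := ((innerSL ℝ ξ).hasFDerivAt (x := x)).pow k
  simpa using h

theorem natCast_mul_pow_pred_mul (k : ℕ) (t : ℝ) : (k : ℝ) * t ^ (k - 1) * t = k * t ^ k := by
  rcases k with _ | k
  · simp
  · simp [pow_succ]; ring

theorem deriv_eq_zero_of_notMem_Icc {χ : ℝ → ℝ} {a R : ℝ} (hz : ∀ r ∉ Set.Icc a R, χ r = 0)
    {r : ℝ} (hr : r ∉ Set.Icc a R) : deriv χ r = 0 := by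
  have : χ =ᶠ[nhds r] fun _ => 0 := by
    filter_upwards [isClosed_Icc.isOpen_compl.mem_nhds hr] with y hy using hz y hy
  simp [this.deriv_eq]

theorem exists_Icc_of_tsupport_subset_Ioi {η : ℝ → ℝ} (hc : HasCompactSupport η)
    (hs : tsupport η ⊆ Set.Ioi 0) : ∃ a R : ℝ, 0 < a ∧ ∀ r ∉ Set.Icc a R, η r = 0 := by
  rcases (tsupport η).eq_empty_or_nonempty with he | hne
  · exact ⟨1, 2, one_pos, fun r _ => image_eq_zero_of_notMem_tsupport (by simp [he])⟩
  · obtain ⟨x, hx, hmin⟩ := hc.isCompact.exists_isMinOn hne continuousOn_id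
    obtain ⟨y, hy, hmax⟩ := hc.isCompact.exists_isMaxOn hne continuousOn_id
    refine ⟨x, y, hs hx, fun r hr => ?_⟩
    by_contra h0
    have hmem := subset_tsupport η h0
    exact hr ⟨hmin hmem, hmax hmem⟩

theorem contDiff_radial_mul_inner_pow {η : ℝ → ℝ} (hη : ContDiff ℝ (⊤ : ℕ∞) η) {a c : ℝ}
    (ha : 0 < a) (hconst : ∀ r ≤ a, η r = c) (ξ : E) (k : ℕ) :
    ContDiff ℝ (⊤ : ℕ∞) fun x : E => η ‖x‖ * ⟪ξ, x⟫ ^ k := by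
  have hp : ContDiff ℝ (⊤ : ℕ∞) fun x : E => ⟪ξ, x⟫ ^ k :=
    (contDiff_const.inner ℝ contDiff_id).pow k
  refine ContDiff.mul ?_ hp
  rw [contDiff_iff_contDiffAt]
  intro x
  by_cases hx : x = 0
  · have : (fun x : E => η ‖x‖) =ᶠ[nhds x] fun _ => c := by
      filter_upwards [Metric.ball_mem_nhds x ha] with y hy
      rw [hx, mem_ball_zero_iff] at hy
      exact hconst _ hy.le
    exact contDiffAt_const.congr_of_eventuallyEq this
  · exact hη.contDiffAt.comp x (contDiffAt_norm ℝ hx)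

theorem hasCompactSupport_radial_mul [FiniteDimensional ℝ E] {η : ℝ → ℝ} {R : ℝ}
    (hR : ∀ r, R < r → η r = 0) (F : E → ℝ) :
    HasCompactSupport fun x : E => η ‖x‖ * F x := by
  refine HasCompactSupport.intro (isCompact_closedBall (0 : E) R) fun x hx => ?_
  rw [mem_closedBall_zero_iff, not_le] at hx
  rw [hR _ hx, zero_mul]

theorem gradient_radial_mul_inner_pow [CompleteSpace E] {η : ℝ → ℝ} (ξ : E) (k : ℕ)
    {x : E} (hx : x ≠ 0)
    (hη : DifferentiableAt ℝ η ‖x‖) :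
    gradient (fun x : E => η ‖x‖ * ⟪ξ, x⟫ ^ k) x =
      (deriv η ‖x‖ * ‖x‖⁻¹ * ⟪ξ, x⟫ ^ k) • x + (η ‖x‖ * (k * ⟪ξ, x⟫ ^ (k - 1))) • ξ := by
  have h := (hasFDerivAt_radial hx hη).mul (hasFDerivAt_inner_pow ξ k x)
  refine HasGradientAt.gradient ?_
  rw [hasGradientAt_iff_hasFDerivAt]
  have e : (InnerProductSpace.toDual ℝ E) ((deriv η ‖x‖ * ‖x‖⁻¹ * ⟪ξ, x⟫ ^ k) • x +
      (η ‖x‖ * (k * ⟪ξ, x⟫ ^ (k - 1))) • ξ) = η ‖x‖ • ((k * ⟪ξ, x⟫ ^ (k - 1)) • innerSL ℝ ξ) +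
      ⟪ξ, x⟫ ^ k • ((deriv η ‖x‖ * ‖x‖⁻¹) • innerSL ℝ x) := by
    ext y
    simp
    ring
  rw [e]
  exact h

theorem inner_gradient_eq_fderiv [CompleteSpace E] (v : E → ℝ) (x y : E) :
    ⟪gradient v x, y⟫ = fderiv ℝ v x y := by
  simp [gradient]

variable [FiniteDimensional ℝ E] [MeasurableSpace E] [BorelSpace E]
  {μ : Measure E} [μ.IsAddHaarMeasure]

/-- Integration by parts in the direction `ξ` against a radial cut-off and a power of `⟪ξ, ·⟫`. -/
theorem integral_radial_mul_fderiv_mul_inner_pow {v : E → ℝ} (hv : ContDiffOn ℝ 1 v {x | x ≠ 0})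
    {χ : ℝ → ℝ} {a R : ℝ} (ha : 0 < a) (hχ : ContDiffOn ℝ 1 χ (Set.Ioi 0))
    (hz : ∀ r ∉ Set.Icc a R, χ r = 0) (ξ : E) (k : ℕ) :
    ∫ x, χ ‖x‖ * (fderiv ℝ v x ξ * (k * ⟪ξ, x⟫ ^ (k - 1))) ∂μ =
      -(∫ x, (deriv χ ‖x‖ * (k / ‖x‖)) * (v x * ⟪ξ, x⟫ ^ k) ∂μ)
      - ∫ x, (χ ‖x‖ * (k * (k - 1 : ℕ) * ‖ξ‖ ^ 2)) * (v x * ⟪ξ, x⟫ ^ (k - 2)) ∂μ := by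
  have hχ' : ContinuousOn (deriv χ) (Set.Ioi 0) :=
    hχ.continuousOn_deriv_of_isOpen isOpen_Ioi le_rfl
  have hz' : ∀ r ∉ Set.Icc a R, deriv χ r = 0 := fun r hr => deriv_eq_zero_of_notMem_Icc hz hr
  have hDv : ContinuousOn (fun x => fderiv ℝ v x ξ) {x | x ≠ 0} :=
    (hv.continuousOn_fderiv_of_isOpen isOpen_ne_zero le_rfl).clm_apply continuousOn_const
  have hpow : ∀ j : ℕ, ContinuousOn (fun x : E => ⟪ξ, x⟫ ^ j) {x | x ≠ 0} := fun j =>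
    Continuous.continuousOn (by fun_prop)
  have i1 : Integrable (fun x => χ ‖x‖ * (fderiv ℝ v x ξ * (k * ⟪ξ, x⟫ ^ (k - 1)))) μ :=
    integrable_radial_mul ha hχ.continuousOn hz (hDv.mul (continuousOn_const.mul (hpow _)))
  have i2 : Integrable (fun x => (deriv χ ‖x‖ * (k / ‖x‖)) * (v x * ⟪ξ, x⟫ ^ k)) μ :=
    integrable_radial_mul (R := R) (χ := fun r => deriv χ r * (k / r)) ha
      (hχ'.mul (continuousOn_const.div continuousOn_id fun x hx => ne_of_gt hx))
      (fun r hr => by simp [hz' r hr]) (hv.continuousOn.mul (hpow k))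
  have i3 : Integrable (fun x => (χ ‖x‖ * (k * (k - 1 : ℕ) * ‖ξ‖ ^ 2)) *
      (v x * ⟪ξ, x⟫ ^ (k - 2))) μ :=
    integrable_radial_mul (R := R) (χ := fun r => χ r * (k * (k - 1 : ℕ) * ‖ξ‖ ^ 2)) ha
      (hχ.continuousOn.mul continuousOn_const)
      (fun r hr => by simp [hz r hr]) (hv.continuousOn.mul (hpow _))
  have i4 : Integrable (fun x => χ ‖x‖ * (v x * (k * ⟪ξ, x⟫ ^ (k - 1)))) μ :=
    integrable_radial_mul ha hχ.continuousOn hz (hv.continuousOn.mul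
      (continuousOn_const.mul (hpow _)))
  set f' : E → ℝ := fun x => (deriv χ ‖x‖ * ‖x‖⁻¹ * ⟪x, ξ⟫) * v x + χ ‖x‖ * fderiv ℝ v x ξ with hf'
  have hfd : ∀ x, HasLineDerivAt ℝ (fun x => χ ‖x‖ * v x) (f' x) x ξ := by
    intro x
    by_cases hx : x = 0
    · have h0 : (fun x => χ ‖x‖ * v x) =ᶠ[nhds x] fun _ => 0 := by
        filter_upwards [Metric.ball_mem_nhds x ha] with y hy
        rw [hx, mem_ball_zero_iff] at hy
        rw [hz ‖y‖ fun h => absurd h.1 (not_le.2 hy), zero_mul]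
      have h1 : (0 : ℝ) ∉ Set.Icc a R := fun h => absurd h.1 (not_le.2 ha)
      have h2 : f' x = 0 := by simp [hf', hx, hz 0 h1]
      rw [h2]
      have := ((hasFDerivAt_const (𝕜 := ℝ) (0 : ℝ) x).congr_of_eventuallyEq h0).hasLineDerivAt ξ
      simpa using this
    · have d1 := hasFDerivAt_radial hx
        ((hχ.contDiffAt (Ioi_mem_nhds (norm_pos_iff.2 hx))).differentiableAt one_ne_zero)
      have d2 := ((hv.contDiffAt (isOpen_ne_zero.mem_nhds hx)).differentiableAt
        one_ne_zero).hasFDerivAt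
      have e : f' x = (χ ‖x‖ • fderiv ℝ v x +
          v x • ((deriv χ ‖x‖ * ‖x‖⁻¹) • innerSL ℝ x)) ξ := by
        simp [hf']
        ring
      rw [e]
      exact (d1.mul d2).hasLineDerivAt ξ
  set g' : E → ℝ := fun x => k * ((k - 1 : ℕ) * ⟪ξ, x⟫ ^ (k - 2) * ‖ξ‖ ^ 2) with hg'
  have hgd : ∀ x, HasLineDerivAt ℝ (fun x => (k : ℝ) * ⟪ξ, x⟫ ^ (k - 1)) (g' x) x ξ := by
    intro x
    have e : g' x = ((k : ℝ) • ((((k - 1 : ℕ) : ℝ) * ⟪ξ, x⟫ ^ (k - 1 - 1)) • innerSL ℝ ξ)) ξ := by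
      simp [hg', Nat.sub_sub]
    rw [e]
    exact ((hasFDerivAt_inner_pow ξ (k - 1) x).const_mul (k : ℝ)).hasLineDerivAt ξ
  have e1 : ∀ x, f' x * (k * ⟪ξ, x⟫ ^ (k - 1)) = (deriv χ ‖x‖ * (k / ‖x‖)) * (v x * ⟪ξ, x⟫ ^ k) +
      χ ‖x‖ * (fderiv ℝ v x ξ * (k * ⟪ξ, x⟫ ^ (k - 1))) := by
    intro x
    have h := natCast_mul_pow_pred_mul k ⟪ξ, x⟫
    simp only [hf', real_inner_comm ξ x]
    linear_combination (deriv χ ‖x‖ * ‖x‖⁻¹ * v x) * h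
  have e2 : ∀ x, (χ ‖x‖ * v x) * g' x =
      (χ ‖x‖ * (k * (k - 1 : ℕ) * ‖ξ‖ ^ 2)) * (v x * ⟪ξ, x⟫ ^ (k - 2)) := by
    intro x; simp only [hg']; ring
  have key := integral_bilinear_hasLineDerivAt_right_eq_neg_left_of_integrable (μ := μ)
    (f := fun x => χ ‖x‖ * v x) (f' := f') (g := fun x => (k : ℝ) * ⟪ξ, x⟫ ^ (k - 1)) (g' := g')
    (v := ξ) (B := ContinuousLinearMap.mul ℝ ℝ)
    (by simp only [ContinuousLinearMap.mul_apply', e1]; exact i2.add i1)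
    (by simp only [ContinuousLinearMap.mul_apply', e2]; exact i3)
    (by simpa only [ContinuousLinearMap.mul_apply', mul_assoc] using i4)
    (fun x _ => hfd x) (fun x _ => hgd x)
  simp only [ContinuousLinearMap.mul_apply', e1, e2] at key
  rw [integral_add i2 i1] at key
  linarith

end WeakForm

section RadialWeak

variable {E : Type*} [NormedAddCommGroup E] [InnerProductSpace ℝ E] [FiniteDimensional ℝ E]
  [MeasurableSpace E] [BorelSpace E] {μ : Measure E} [μ.IsAddHaarMeasure]

variable (μ) in
/-- `v` solves weakly `-div (w(|x|) (∇v + (p-2) (x·∇v) x/|x|²)) = V(|x|) v`. -/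
def IsRadialWeakSolution (p : ℝ) (w V : ℝ → ℝ) (v : E → ℝ) : Prop :=
  ∀ φ : E → ℝ, ContDiff ℝ (⊤ : ℕ∞) φ → HasCompactSupport φ →
    ∫ x, w ‖x‖ * (⟪gradient v x, gradient φ x⟫ +
      (p - 2) * (⟪x, gradient v x⟫ * ⟪x, gradient φ x⟫ / ‖x‖ ^ 2)) ∂μ =
    ∫ x, V ‖x‖ * (v x * φ x) ∂μ

theorem natCast_mul_pow_pred_two (k : ℕ) {r : ℝ} (hr : r ≠ 0) :
    (k : ℝ) * (k - 1 : ℕ) * r ^ (k - 2) = k * (k - 1) * (r ^ k / r ^ 2) := by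
  rcases k with _ | _ | k
  · simp
  · simp
  · push_cast
    field_simp
    ring

variable [Nontrivial E]

omit [MeasurableSpace E] [BorelSpace E] [Nontrivial E] in
theorem radial_flux_eq (p : ℝ) (v : E → ℝ) (ξ : E) (k : ℕ) {η : ℝ → ℝ} {x : E} (hx : x ≠ 0)
    (hη : DifferentiableAt ℝ η ‖x‖) (W : ℝ) :
    W * (⟪gradient v x, gradient (fun x : E => η ‖x‖ * ⟪ξ, x⟫ ^ k) x⟫ +
      (p - 2) * (⟪x, gradient v x⟫ * ⟪x, gradient (fun x : E => η ‖x‖ * ⟪ξ, x⟫ ^ k) x⟫ /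
        ‖x‖ ^ 2)) =
    (W * ((p - 1) * deriv η ‖x‖ + (p - 2) * (k / ‖x‖) * η ‖x‖)) *
      (radialDeriv v x * ⟪ξ, x⟫ ^ k) +
    (W * η ‖x‖) * (fderiv ℝ v x ξ * (k * ⟪ξ, x⟫ ^ (k - 1))) := by
  have hr : ‖x‖ ≠ 0 := norm_ne_zero_iff.2 hx
  rw [gradient_radial_mul_inner_pow ξ k hx hη, real_inner_comm (gradient v x) x]
  simp only [inner_add_right, inner_smul_right, inner_gradient_eq_fderiv,
    real_inner_self_eq_norm_sq, radialDeriv, real_inner_comm ξ x]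
  have h := natCast_mul_pow_pred_mul k ⟪ξ, x⟫
  field_simp
  linear_combination (W * (p - 2) * (fderiv ℝ v x) x * η ‖x‖) * h

theorem integral_radial_mul_moment_of_Icc {χ : ℝ → ℝ} {F : E → ℝ} {a R : ℝ} (ha : 0 < a)
    (hχ : ContinuousOn χ (Set.Ioi 0)) (hz : ∀ r ∉ Set.Icc a R, χ r = 0)
    (hF : ContinuousOn F {x | x ≠ 0}) (ξ : E) (k : ℕ) :
    Integrable (fun x => χ ‖x‖ * (F x * ⟪ξ, x⟫ ^ k)) μ ∧
    IntegrableOn (fun r => r ^ (Module.finrank ℝ E - 1) * (χ r * (r ^ k * sphereMoment μ F ξ k r)))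
      (Set.Ioi 0) ∧
    ∫ x, χ ‖x‖ * (F x * ⟪ξ, x⟫ ^ k) ∂μ = ∫ r in Set.Ioi (0 : ℝ),
      r ^ (Module.finrank ℝ E - 1) * (χ r * (r ^ k * sphereMoment μ F ξ k r)) := by
  have h : Integrable (fun x => χ ‖x‖ * (F x * ⟪ξ, x⟫ ^ k)) μ :=
    integrable_radial_mul ha hχ hz (hF.mul (Continuous.continuousOn (by fun_prop)))
  exact ⟨h, integral_radial_mul_moment h⟩

theorem IsRadialWeakSolution.hasDerivAt_flux_moment {p : ℝ} {w V : ℝ → ℝ} {v : E → ℝ}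
    (h : IsRadialWeakSolution μ p w V v) (hw : ContDiffOn ℝ 1 w (Set.Ioi 0))
    (hV : ContinuousOn V (Set.Ioi 0)) (hv : ContDiffOn ℝ 1 v {x | x ≠ 0}) (ξ : E) (k : ℕ)
    {r : ℝ} (hr : 0 < r) :
    HasDerivAt (fun r => r ^ (Module.finrank ℝ E - 1) * (w r * (r ^ k *
        ((p - 1) * sphereMoment μ (radialDeriv v) ξ k r - k / r * sphereMoment μ v ξ k r))))
      (r ^ (Module.finrank ℝ E - 1) * (r ^ k *
        ((p - 2) * (k / r) * w r * sphereMoment μ (radialDeriv v) ξ k r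
          - deriv w r * (k / r) * sphereMoment μ v ξ k r
          - w r * (k * (k - 1) * ‖ξ‖ ^ 2 / r ^ 2) * sphereMoment μ v ξ (k - 2) r
          - V r * sphereMoment μ v ξ k r))) r := by
  have hvr := continuousOn_radialDeriv hv
  have hw' : ContinuousOn (deriv w) (Set.Ioi 0) :=
    hw.continuousOn_deriv_of_isOpen isOpen_Ioi le_rfl
  have hm' := continuousOn_sphereMoment (μ := μ) hvr ξ k
  have hm := continuousOn_sphereMoment (μ := μ) hv.continuousOn ξ k
  have hm2 := continuousOn_sphereMoment (μ := μ) hv.continuousOn ξ (k - 2)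
  have hinv : ContinuousOn (fun r : ℝ => k / r) (Set.Ioi 0) :=
    continuousOn_const.div continuousOn_id fun x hx => ne_of_gt hx
  have hinv2 : ContinuousOn (fun r : ℝ => k * (k - 1) * ‖ξ‖ ^ 2 / r ^ 2) (Set.Ioi 0) :=
    continuousOn_const.div (continuousOn_id.pow 2) fun x hx => pow_ne_zero 2 (ne_of_gt hx)
  have hpow : ∀ j : ℕ, ContinuousOn (fun r : ℝ => r ^ j) (Set.Ioi 0) := fun j =>
    (continuous_pow j).continuousOn
  refine hasDerivAt_of_forall_integral_test
    ((hpow _).mul (hw.continuousOn.mul ((hpow k).mul ((continuousOn_const.mul hm').sub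
      (hinv.mul hm)))))
    ((hpow _).mul ((hpow k).mul (((((continuousOn_const.mul hinv).mul hw.continuousOn).mul
      hm').sub ((hw'.mul hinv).mul hm)).sub ((hw.continuousOn.mul hinv2).mul hm2)
      |>.sub (hV.mul hm)))) ?_ r hr
  intro η hη hηc hηs
  obtain ⟨a, R, ha, hz⟩ := exists_Icc_of_tsupport_subset_Ioi hηc hηs
  have hη' : Continuous (deriv η) := hη.continuous_deriv (by simp)
  have hz' : ∀ r ∉ Set.Icc a R, deriv η r = 0 := fun r hr => deriv_eq_zero_of_notMem_Icc hz hr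
  have hη1 : ContDiff ℝ 1 η := hη.of_le (by simp)
  have hχ : ContDiffOn ℝ 1 (fun r => w r * η r) (Set.Ioi 0) := hw.mul hη1.contDiffOn
  have hχz : ∀ r ∉ Set.Icc a R, w r * η r = 0 := fun r hr => by rw [hz r hr, mul_zero]
  have hφ : ContDiff ℝ (⊤ : ℕ∞) fun x : E => η ‖x‖ * ⟪ξ, x⟫ ^ k :=
    contDiff_radial_mul_inner_pow hη (half_pos ha) (c := 0)
      (fun r hr => hz r fun hm => by linarith [hm.1]) ξ k
  have hφc : HasCompactSupport fun x : E => η ‖x‖ * ⟪ξ, x⟫ ^ k :=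
    hasCompactSupport_radial_mul (R := R) (fun r hr => hz r fun hm => by linarith [hm.2]) _
  have key := h _ hφ hφc
  obtain ⟨i1, j1, e1⟩ := integral_radial_mul_moment_of_Icc (μ := μ) (R := R)
    (χ := fun r => w r * ((p - 1) * deriv η r + (p - 2) * (k / r) * η r)) ha
    (hw.continuousOn.mul ((continuousOn_const.mul hη'.continuousOn).add
      ((continuousOn_const.mul hinv).mul hη.continuous.continuousOn)))
    (fun r hr => by simp [hz r hr, hz' r hr]) hvr ξ k
  obtain ⟨i2, j2, e2⟩ := integral_radial_mul_moment_of_Icc (μ := μ) (R := R)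
    (χ := fun r => deriv (fun r => w r * η r) r * (k / r)) ha
    ((hχ.continuousOn_deriv_of_isOpen isOpen_Ioi le_rfl).mul hinv)
    (fun r hr => by simp [deriv_eq_zero_of_notMem_Icc hχz hr]) hv.continuousOn ξ k
  obtain ⟨i3, j3, e3⟩ := integral_radial_mul_moment_of_Icc (μ := μ) (R := R)
    (χ := fun r => (w r * η r) * (k * (k - 1 : ℕ) * ‖ξ‖ ^ 2)) ha
    (hχ.continuousOn.mul continuousOn_const)
    (fun r hr => by simp [hz r hr]) hv.continuousOn ξ (k - 2)
  obtain ⟨i4, j4, e4⟩ := integral_radial_mul_moment_of_Icc (μ := μ) (R := R)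
    (χ := fun r => V r * η r) ha
    (hV.mul hη.continuous.continuousOn)
    (fun r hr => by simp [hz r hr]) hv.continuousOn ξ k
  have i5 : Integrable (fun x => (w ‖x‖ * η ‖x‖) *
      (fderiv ℝ v x ξ * (k * ⟪ξ, x⟫ ^ (k - 1)))) μ :=
    integrable_radial_mul (χ := fun r => w r * η r) ha hχ.continuousOn hχz
      (((hv.continuousOn_fderiv_of_isOpen isOpen_ne_zero le_rfl).clm_apply continuousOn_const).mul
        (Continuous.continuousOn (by fun_prop)))
  have hae : ∀ᵐ x ∂μ, x ≠ 0 := by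
    simp [ae_iff]
  rw [integral_congr_ae (hae.mono fun x hx =>
      radial_flux_eq p v ξ k hx hη1.differentiable_one.differentiableAt (w ‖x‖)),
    integral_add i1 i5,
    integral_radial_mul_fderiv_mul_inner_pow (χ := fun r => w r * η r) hv ha hχ hχz ξ k,
    e1, e2, e3] at key
  have e4' : ∫ x, V ‖x‖ * (v x * (η ‖x‖ * ⟪ξ, x⟫ ^ k)) ∂μ =
      ∫ x, V ‖x‖ * η ‖x‖ * (v x * ⟪ξ, x⟫ ^ k) ∂μ := by
    congr 1; ext x; ring
  rw [e4', e4, ← sub_eq_zero] at key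
  have s2 := integral_sub (j1.sub j2) j3
  have s3 := integral_sub ((j1.sub j2).sub j3) j4
  simp only [Pi.sub_apply] at s2 s3
  rw [← add_sub_assoc, ← sub_eq_add_neg, ← integral_sub j1 j2, ← s2, ← s3] at key
  rw [← setIntegral_eq_integral_of_forall_compl_eq_zero (s := Set.Ioi 0) fun r hr => by
    have hm : r ∉ Set.Icc a R := fun hm => hr (ha.trans_le hm.1)
    simp [hz r hm, hz' r hm]]
  refine Eq.trans ?_ key
  refine setIntegral_congr_fun (measurableSet_Ioi (a := (0 : ℝ))) fun r hr => ?_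
  have hr0 : r ≠ 0 := ne_of_gt hr
  have hd : deriv (fun r => w r * η r) r = deriv w r * η r + w r * deriv η r :=
    deriv_fun_mul
      ((hw.contDiffAt (Ioi_mem_nhds (show (0 : ℝ) < r from hr))).differentiableAt one_ne_zero)
      hη1.differentiable_one.differentiableAt
  have h2 := natCast_mul_pow_pred_two k hr0
  simp only [hd, Pi.mul_apply, Pi.sub_apply]
  linear_combination (r ^ (Module.finrank ℝ E - 1) * w r * η r * ‖ξ‖ ^ 2 *
    sphereMoment μ v ξ (k - 2) r) * h2

theorem IsRadialWeakSolution.hasDerivAt_moment {p : ℝ} {w V : ℝ → ℝ} {v : E → ℝ}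
    (h : IsRadialWeakSolution μ p w V v) (hp : 1 < p) (hw : ContDiffOn ℝ 1 w (Set.Ioi 0))
    (hV : ContinuousOn V (Set.Ioi 0)) (hv : ContDiffOn ℝ 1 v {x | x ≠ 0}) (ξ : E) (k : ℕ)
    {r : ℝ} (hr : 0 < r) :
    HasDerivAt (fun r => r ^ (Module.finrank ℝ E - 1) * (w r *
        sphereMoment μ (radialDeriv v) ξ k r))
      (r ^ (Module.finrank ℝ E - 1) * ((w r * ((k * ((Module.finrank ℝ E - 1 : ℕ) + k - 1)) *
          sphereMoment μ v ξ k r - k * (k - 1) * ‖ξ‖ ^ 2 * sphereMoment μ v ξ (k - 2) r) / r ^ 2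
          - V r * sphereMoment μ v ξ k r) / (p - 1))) r := by
  set n := Module.finrank ℝ E - 1
  have hp0 : p - 1 ≠ 0 := by linarith
  have h1 := h.hasDerivAt_flux_moment hw hV hv ξ k hr
  have hwd := ((hw.contDiffAt (Ioi_mem_nhds hr)).differentiableAt one_ne_zero).hasDerivAt
  have hmd := hasDerivAt_sphereMoment (μ := μ) hv ξ k hr
  have hn : ∀ j : ℕ, HasDerivAt (fun r : ℝ => r ^ j) (j * (r ^ j / r)) r := fun j => by
    have h := hasDerivAt_pow j r
    rwa [show (j : ℝ) * r ^ (j - 1) = j * (r ^ j / r) by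
      rw [mul_div_assoc', ← natCast_mul_pow_pred_mul, mul_div_cancel_right₀ _ hr.ne']] at h
  have h2 := (h1.add (((hn n).mul (hn k)).mul ((hwd.mul hmd).mul
    ((hasDerivAt_inv hr.ne').const_mul (k : ℝ))))).div ((hn k).const_mul (p - 1))
    (mul_ne_zero hp0 (pow_ne_zero _ hr.ne'))
  have e : HasDerivAt (fun r => r ^ n * (w r * sphereMoment μ (radialDeriv v) ξ k r)) _ r :=
    h2.congr_of_eventuallyEq (by
      filter_upwards [Ioi_mem_nhds hr] with s hs
      have hs' : s ≠ 0 := ne_of_gt hs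
      simp only [Pi.add_apply, Pi.mul_apply, Pi.div_apply]
      field_simp
      ring)
  convert e using 1
  simp only [Pi.add_apply, Pi.mul_apply]
  field_simp
  ring

theorem sphereMoment_one_recursion (ξ : E) (k : ℕ) :
    k * ((Module.finrank ℝ E - 1 : ℕ) + k - 1) * sphereMoment μ (fun _ => 1) ξ k 1 =
      k * (k - 1) * ‖ξ‖ ^ 2 * sphereMoment μ (fun _ => 1) ξ (k - 2) 1 := by
  set n := Module.finrank ℝ E - 1 with hn
  set J : ℕ → ℝ := fun k => sphereMoment μ (fun _ => 1) ξ k 1 with hJ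
  have hJr : ∀ k r, sphereMoment μ (fun _ => 1) ξ k r = J k := fun k r => rfl
  have hinv : ContinuousOn (fun r : ℝ => k / r) (Set.Ioi 0) :=
    continuousOn_const.div continuousOn_id fun x hx => ne_of_gt hx
  have hinv2 : ContinuousOn (fun r : ℝ => k * (k - 1) * ‖ξ‖ ^ 2 / r ^ 2) (Set.Ioi 0) :=
    continuousOn_const.div (continuousOn_id.pow 2) fun x hx => pow_ne_zero 2 (ne_of_gt hx)
  have hpow : ∀ j : ℕ, ContinuousOn (fun r : ℝ => r ^ j) (Set.Ioi 0) := fun j =>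
    (continuous_pow j).continuousOn
  have h1 : HasDerivAt (fun r => r ^ n * (r ^ k * (k / r * J k)))
      ((1 : ℝ) ^ n * (1 ^ k * (k * (k - 1) * ‖ξ‖ ^ 2 / 1 ^ 2 * J (k - 2)))) 1 := by
    refine hasDerivAt_of_forall_integral_test
      (g := fun r => r ^ n * (r ^ k * (k * (k - 1) * ‖ξ‖ ^ 2 / r ^ 2 * J (k - 2))))
      ((hpow n).mul ((hpow k).mul (hinv.mul continuousOn_const)))
      ((hpow n).mul ((hpow k).mul (hinv2.mul continuousOn_const))) ?_ 1 one_pos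
    intro η hη hηc hηs
    obtain ⟨a, R, ha, hz⟩ := exists_Icc_of_tsupport_subset_Ioi hηc hηs
    have hη' : Continuous (deriv η) := hη.continuous_deriv (by simp)
    have hz' : ∀ r ∉ Set.Icc a R, deriv η r = 0 := fun r hr => deriv_eq_zero_of_notMem_Icc hz hr
    have hη1 : ContDiff ℝ 1 η := hη.of_le (by simp)
    have key := integral_radial_mul_fderiv_mul_inner_pow (μ := μ) (v := fun _ : E => (1 : ℝ))
      contDiffOn_const ha hη1.contDiffOn hz ξ k
    obtain ⟨-, j2, e2⟩ := integral_radial_mul_moment_of_Icc (μ := μ) (R := R)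
      (χ := fun r => deriv η r * (k / r)) (F := fun _ => 1) ha
      (hη'.continuousOn.mul hinv) (fun r hr => by simp [hz' r hr]) continuousOn_const ξ k
    obtain ⟨-, j3, e3⟩ := integral_radial_mul_moment_of_Icc (μ := μ) (R := R)
      (χ := fun r => η r * (k * (k - 1 : ℕ) * ‖ξ‖ ^ 2)) (F := fun _ => 1) ha
      (hη.continuous.continuousOn.mul continuousOn_const)
      (fun r hr => by simp [hz r hr]) continuousOn_const ξ (k - 2)
    rw [e2, e3] at key
    simp only [fderiv_fun_const, Pi.zero_apply, _root_.zero_apply, zero_mul, mul_zero,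
      integral_zero] at key
    have s2 := integral_add j2 j3
    rw [← setIntegral_eq_integral_of_forall_compl_eq_zero (s := Set.Ioi 0) fun r hr => by
      have hm : r ∉ Set.Icc a R := fun hm => hr (ha.trans_le hm.1)
      simp [hz r hm, hz' r hm]]
    trans ∫ r in Set.Ioi 0, (r ^ n * (deriv η r * (k / r) * (r ^ k *
        sphereMoment μ (fun _ => 1) ξ k r)) + r ^ n * (η r * (k * (k - 1 : ℕ) * ‖ξ‖ ^ 2) *
        (r ^ (k - 2) * sphereMoment μ (fun _ => 1) ξ (k - 2) r)))
    · refine setIntegral_congr_fun (measurableSet_Ioi (a := (0 : ℝ))) fun r hr => ?_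
      have h2 := natCast_mul_pow_pred_two k (ne_of_gt hr)
      simp only [hJr, Pi.mul_apply]
      linear_combination - (r ^ n * η r * ‖ξ‖ ^ 2 * J (k - 2)) * h2
    · rw [s2]; linarith
  have h2 := ((hasDerivAt_pow n (1 : ℝ)).mul ((hasDerivAt_pow k (1 : ℝ)).mul
    (((hasDerivAt_inv (one_ne_zero (α := ℝ))).const_mul (k : ℝ)).mul_const (J k))))
  have h3 := h1.unique h2
  simp only [one_pow, Pi.mul_apply] at h3
  simp only [hJ] at h3 ⊢
  linear_combination -h3

theorem IsRadialWeakSolution.tendsto_flux_zero {p : ℝ} {w V : ℝ → ℝ} {v : E → ℝ}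
    (h : IsRadialWeakSolution μ p w V v) (hp : 1 < p) (hw : ContinuousOn w (Set.Ioi 0))
    (hV : ContinuousOn V (Set.Ici 0)) (hv : ContDiffOn ℝ 1 v {x | x ≠ 0}) (hvc : Continuous v)
    (ξ : E) :
    Filter.Tendsto (fun r => r ^ (Module.finrank ℝ E - 1) * (w r *
        sphereMoment μ (radialDeriv v) ξ 0 r)) (nhdsWithin 0 (Set.Ioi 0)) (nhds 0) := by
  set n := Module.finrank ℝ E - 1 with hn
  have hvr := continuousOn_radialDeriv hv
  have hm' := continuousOn_sphereMoment (μ := μ) hvr ξ 0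
  have hm := continuous_sphereMoment (μ := μ) hvc ξ 0
  have hVa : Continuous fun r : ℝ => V |r| :=
    hV.comp_continuous continuous_abs fun r => abs_nonneg r
  have hpow : ∀ j : ℕ, ContinuousOn (fun r : ℝ => r ^ j) (Set.Ioi 0) := fun j =>
    (continuous_pow j).continuousOn
  set B : ℝ → ℝ := fun r => r ^ n * (V |r| * sphereMoment μ v ξ 0 r) with hB
  have hBc : Continuous B := (continuous_pow n).mul (hVa.mul hm)
  set I : ℝ → ℝ := fun r => ∫ s in (0 : ℝ)..r, B s with hI
  have hId : ∀ r, HasDerivAt I (B r) r := fun r => hBc.integral_hasStrictDerivAt 0 r |>.hasDerivAt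
  have hIc : Continuous I := continuous_iff_continuousAt.2 fun r => (hId r).continuousAt
  have hae : ∀ᵐ x ∂μ, x ≠ 0 := by
    simp [ae_iff]
  have key : ∀ r, 0 < r → (p - 1) * (r ^ n * (w r * sphereMoment μ (radialDeriv v) ξ 0 r)) + I r
      = 0 := by
    refine eq_zero_of_forall_integral_test_mul
      ((continuousOn_const.mul ((hpow n).mul (hw.mul hm'))).add hIc.continuousOn) ?_
    intro ρ hρ hρc hρs
    obtain ⟨η, a, R, ha, haR, hη, hηρ, hη0, hηR⟩ := exists_primitive_of_test hρ hρc hρs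
    have hρR : ∀ r, R ≤ r → ρ r = 0 := by
      intro r hr
      rw [← hηρ, ← (hη.differentiable (by simp)).differentiableAt.derivWithin
        (uniqueDiffWithinAt_Ici r), derivWithin_congr
        (show Set.EqOn η (fun _ => 0) (Set.Ici r) from fun s hs => hηR s (hr.trans hs)) (hηR r hr)]
      simp
    obtain ⟨a', R', ha', hz⟩ := exists_Icc_of_tsupport_subset_Ioi hρc hρs
    have hη1 : ContDiff ℝ 1 η := hη.of_le (by simp)
    have hφ := contDiff_radial_mul_inner_pow hη ha hη0 ξ 0
    have hφc : HasCompactSupport fun x : E => η ‖x‖ * ⟪ξ, x⟫ ^ 0 :=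
      hasCompactSupport_radial_mul (R := R) (fun r hr => hηR r hr.le) _
    have key := h _ hφ hφc
    obtain ⟨i1, j1, e1⟩ := integral_radial_mul_moment_of_Icc (μ := μ) (R := R')
      (χ := fun r => w r * ((p - 1) * ρ r)) ha'
      (hw.mul (continuousOn_const.mul hρ.continuous.continuousOn))
      (fun r hr => by simp [hz r hr]) hvr ξ 0
    have i2 : Integrable (fun x => (V |‖x‖| * η ‖x‖) * (v x * ⟪ξ, x⟫ ^ 0)) μ := by
      have hc : Continuous fun x : E => η ‖x‖ * (V |‖x‖| * (v x * ⟪ξ, x⟫ ^ 0)) :=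
        (hη.continuous.comp continuous_norm).mul ((hVa.comp continuous_norm).mul
          (hvc.mul (by fun_prop)))
      have := hc.integrable_of_hasCompactSupport (μ := μ)
        (hasCompactSupport_radial_mul (R := R) (fun r hr => hηR r hr.le) _)
      refine this.congr (Filter.Eventually.of_forall fun x => ?_)
      ring
    obtain ⟨j2, e2⟩ := integral_radial_mul_moment (χ := fun r => V |r| * η r) i2
    rw [integral_congr_ae (hae.mono fun x hx =>
      radial_flux_eq p v ξ 0 hx hη1.differentiable_one.differentiableAt (w ‖x‖))] at key
    simp only [hηρ, Nat.cast_zero, zero_mul, mul_zero, add_zero, zero_div] at key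
    rw [e1] at key
    have e2' : ∫ x, V ‖x‖ * (v x * (η ‖x‖ * ⟪ξ, x⟫ ^ 0)) ∂μ =
        ∫ x, V |‖x‖| * η ‖x‖ * (v x * ⟪ξ, x⟫ ^ 0) ∂μ := by
      congr 1; ext x; rw [abs_norm]; ring
    rw [e2', e2] at key
    have e3 : ∫ r in Set.Ioi (0 : ℝ), r ^ n * (V |r| * η r * (r ^ 0 * sphereMoment μ v ξ 0 r)) =
        ∫ r in (0 : ℝ)..R, η r * B r := by
      rw [intervalIntegral.integral_of_le (ha.trans haR).le]
      rw [setIntegral_eq_of_subset_of_forall_sdiff_eq_zero (s := Set.Ioc 0 R) measurableSet_Ioi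
        Set.Ioc_subset_Ioi_self]
      · refine setIntegral_congr_fun measurableSet_Ioc fun r hr => ?_
        simp only [hB]; ring
      · intro r hr
        have : R ≤ r := by
          by_contra! hlt
          exact hr.2 ⟨hr.1, hlt.le⟩
        simp [hηR r this]
    have e4 := intervalIntegral.integral_mul_deriv_eq_deriv_mul (a := 0) (b := R)
      (u := η) (v := I) (u' := ρ) (v' := B)
      (fun r _ => hηρ ▸ hη1.differentiable_one.differentiableAt.hasDerivAt) (fun r _ => hId r)
      (hρ.continuous.intervalIntegrable _ _) (hBc.intervalIntegrable _ _)
    have e5 : ∫ r in Set.Ioi (0 : ℝ), ρ r * I r = ∫ r in (0 : ℝ)..R, ρ r * I r := by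
      rw [intervalIntegral.integral_of_le (ha.trans haR).le]
      refine setIntegral_eq_of_subset_of_forall_sdiff_eq_zero measurableSet_Ioi
        Set.Ioc_subset_Ioi_self fun r hr => ?_
      have : R ≤ r := by
        by_contra! hlt
        exact hr.2 ⟨hr.1, hlt.le⟩
      rw [hρR r this, zero_mul]
    have hI0 : I 0 = 0 := intervalIntegral.integral_same
    rw [hηR R le_rfl, hI0, zero_mul, mul_zero, sub_zero, zero_sub] at e4
    have j3 : IntegrableOn (fun r => ρ r * I r) (Set.Ioi 0) :=
      ((hρ.continuous.mul hIc).integrable_of_hasCompactSupport hρc.mul_right).integrableOn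
    have s2 := integral_add j1 j3
    rw [← setIntegral_eq_integral_of_forall_compl_eq_zero (s := Set.Ioi 0) fun r hr => by
      rw [hz r fun hm => hr (ha'.trans_le hm.1), zero_mul]]
    rw [key, e5, e3, e4] at s2
    refine Eq.trans ?_ (s2.trans (neg_add_cancel _))
    refine setIntegral_congr_fun (measurableSet_Ioi (a := (0 : ℝ))) fun r hr => ?_
    ring
  have h0 : Filter.Tendsto (fun r => -(p - 1)⁻¹ * I r) (nhdsWithin 0 (Set.Ioi 0)) (nhds 0) := by
    have : Filter.Tendsto (fun r => -(p - 1)⁻¹ * I r) (nhds 0) (nhds (-(p - 1)⁻¹ * I 0)) :=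
      (continuous_const.mul hIc).tendsto 0
    simp only [hI, intervalIntegral.integral_same, mul_zero] at this
    exact this.mono_left nhdsWithin_le_nhds
  refine h0.congr' ?_
  filter_upwards [self_mem_nhdsWithin] with r hr
  have := key r hr
  have hp0 : p - 1 ≠ 0 := by linarith
  field_simp
  linarith

end RadialWeak

section LinearODE

theorem add_mul_sub_le_of_le_hasDerivAt {f f' : ℝ → ℝ} {T d : ℝ}
    (hf : ∀ t, T ≤ t → HasDerivAt f (f' t) t) (hd : ∀ t, T ≤ t → d ≤ f' t) {t : ℝ} (ht : T ≤ t) :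
    f T + d * (t - T) ≤ f t := by
  have h := (convex_Ici T).mul_sub_le_image_sub_of_le_deriv (f := f) (C := d)
    (fun s hs => (hf s hs).continuousAt.continuousWithinAt)
    (fun s hs => (hf s (interior_subset hs)).differentiableAt.differentiableWithinAt)
    (fun s hs => by rw [(hf s (interior_subset hs)).deriv]; exact hd s (interior_subset hs))
    T Set.self_mem_Ici t ht ht
  linarith

/-- The product `W M N` cannot become positive near `+∞` if `M` is bounded. -/
theorem weight_mul_mul_deriv_nonpos {W M N q c : ℝ → ℝ} {T c₀ Q K : ℝ}
    (hW : ∀ t, 0 < W t) (hWd : ∀ t, HasDerivAt W (q t * W t) t)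
    (hM : ∀ t, HasDerivAt M (N t) t) (hN : ∀ t, HasDerivAt N (c t * M t - q t * N t) t)
    (hc₀ : 0 < c₀) (hc : ∀ t, T ≤ t → c₀ ≤ c t) (hQ : ∀ t, |q t| ≤ Q) (hK : ∀ t, |M t| ≤ K)
    {t : ℝ} (ht : T ≤ t) : W t * (M t * N t) ≤ 0 := by
  by_contra! hpos
  have hMN : 0 < M t * N t := pos_of_mul_pos_right hpos (hW t).le
  have hΦ : ∀ s, HasDerivAt (fun s => W s * (M s * N s)) (W s * (N s ^ 2 + c s * M s ^ 2)) s := by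
    intro s
    refine ((hWd s).mul ((hM s).mul (hN s))).congr_deriv ?_
    simp only [Pi.mul_apply]
    ring
  have hΦpos : ∀ s, t ≤ s → 0 < M s * N s := by
    intro s hs
    have := add_mul_sub_le_of_le_hasDerivAt (d := 0) (fun s (_ : t ≤ s) => hΦ s)
      (fun s hs => mul_nonneg (hW s).le
        (add_nonneg (sq_nonneg _) (mul_nonneg (hc₀.le.trans (hc s (ht.trans hs))) (sq_nonneg _)))) hs
    exact pos_of_mul_pos_right (by linarith : 0 < W s * (M s * N s)) (hW s).le
  have hM2 : ∀ s, t ≤ s → M t ^ 2 ≤ M s ^ 2 := by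
    intro s hs
    have := add_mul_sub_le_of_le_hasDerivAt (d := 0) (f := fun s => M s ^ 2)
      (f' := fun s => 2 * (M s * N s)) (fun s (_ : t ≤ s) => by
        exact ((hM s).fun_pow 2).congr_deriv (by ring)) (fun s hs => by linarith [hΦpos s hs]) hs
    linarith
  have hMt : 0 < M t ^ 2 := by
    have : M t ≠ 0 := left_ne_zero_of_mul hMN.ne'
    positivity
  have hQ0 : 0 ≤ Q := (abs_nonneg _).trans (hQ 0)
  set ε := min (M t * N t) (c₀ * M t ^ 2 / (Q + 1)) with hε
  have hεpos : 0 < ε := lt_min hMN (by positivity)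
  have hε1 : ε ≤ M t * N t := min_le_left _ _
  have hε2 : ε * (Q + 1) ≤ c₀ * M t ^ 2 := by
    rw [← le_div_iff₀ (by positivity)]; exact min_le_right _ _
  have hge : ∀ s, t ≤ s → ε ≤ M s * N s := by
    intro s hs
    have h1 := add_mul_sub_le_of_le_hasDerivAt (d := 0) (f := fun s => W s * (M s * N s) - ε * W s)
      (fun s (_ : t ≤ s) => (hΦ s).sub ((hWd s).const_mul ε)) (fun s hs => by
        have h2 : c₀ * M t ^ 2 ≤ c s * M s ^ 2 :=
          mul_le_mul (hc s (ht.trans hs)) (hM2 s hs) hMt.le (hc₀.le.trans (hc s (ht.trans hs)))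
        have h3 : ε * q s ≤ ε * Q := mul_le_mul_of_nonneg_left ((le_abs_self _).trans (hQ s)) hεpos.le
        have h4 : 0 ≤ N s ^ 2 + c s * M s ^ 2 - ε * q s := by nlinarith [sq_nonneg (N s)]
        have := mul_nonneg (hW s).le h4
        linarith) hs
    have h5 : 0 ≤ W t * (M t * N t - ε) := mul_nonneg (hW t).le (by linarith)
    have h6 : 0 ≤ W s * (M s * N s - ε) := by nlinarith
    have := nonneg_of_mul_nonneg_right h6 (hW s)
    linarith
  have hgrow := add_mul_sub_le_of_le_hasDerivAt (d := 2 * ε) (f := fun s => M s ^ 2)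
      (f' := fun s => 2 * (M s * N s)) (T := t) (t := t + K ^ 2 / ε) (fun s (_ : t ≤ s) => by
        exact ((hM s).fun_pow 2).congr_deriv (by ring)) (fun s hs => by linarith [hge s hs])
      (by have : 0 ≤ K ^ 2 / ε := by positivity
          linarith)
  have hb := sq_le_sq' (neg_le_of_abs_le (hK (t + K ^ 2 / ε))) (le_of_abs_le (hK (t + K ^ 2 / ε)))
  have : 2 * ε * (t + K ^ 2 / ε - t) = 2 * K ^ 2 := by field_simp; ring
  nlinarith [sq_nonneg K]

theorem monotone_nonpos_of_le_energy {W M N q c G : ℝ → ℝ} {T c₀ Q K C : ℝ}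
    (hW : ∀ t, 0 < W t) (hWd : ∀ t, HasDerivAt W (q t * W t) t)
    (hM : ∀ t, HasDerivAt M (N t) t) (hN : ∀ t, HasDerivAt N (c t * M t - q t * N t) t)
    (hc₀ : 0 < c₀) (hc : ∀ t, T ≤ t → c₀ ≤ c t) (hQ : ∀ t, |q t| ≤ Q) (hK : ∀ t, |M t| ≤ K)
    (hG : Monotone G) (hC : 0 < C) (hGC : ∀ t, G t ≤ C * (W t * (M t ^ 2 + N t ^ 2))) (t : ℝ) :
    G t ≤ 0 := by
  by_contra! hpos
  set S := max T t
  set m := min 1 c₀ with hm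
  have hm0 : 0 < m := lt_min one_pos hc₀
  have hd : 0 < m * (G t / C) := by positivity
  have hΦ : ∀ s, HasDerivAt (fun s => W s * (M s * N s)) (W s * (N s ^ 2 + c s * M s ^ 2)) s := by
    intro s
    refine ((hWd s).mul ((hM s).mul (hN s))).congr_deriv ?_
    simp only [Pi.mul_apply]
    ring
  set D := m * (G t / C) with hD
  set Φ : ℝ → ℝ := fun s => W s * (M s * N s) with hΦd
  have hX : 0 ≤ (1 + |Φ S|) / D := by positivity
  have hgrow := add_mul_sub_le_of_le_hasDerivAt (d := D) (T := S)
    (t := S + (1 + |Φ S|) / D) (fun s (_ : S ≤ s) => hΦ s) (fun s hs => by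
      have h1 : G t ≤ C * (W s * (M s ^ 2 + N s ^ 2)) :=
        (hG ((le_max_right _ _).trans hs)).trans (hGC s)
      have h2 : G t / C ≤ W s * (M s ^ 2 + N s ^ 2) := by
        rw [div_le_iff₀ hC]; linarith
      have h3 : m * (M s ^ 2 + N s ^ 2) ≤ N s ^ 2 + c s * M s ^ 2 := by
        have h4 := hc s ((le_max_left _ _).trans hs)
        have h5 : m ≤ 1 := min_le_left _ _
        have h6 : m ≤ c s := (min_le_right _ _).trans h4
        nlinarith [sq_nonneg (N s), sq_nonneg (M s)]
      calc D ≤ m * (W s * (M s ^ 2 + N s ^ 2)) := mul_le_mul_of_nonneg_left h2 hm0.le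
        _ = W s * (m * (M s ^ 2 + N s ^ 2)) := by ring
        _ ≤ _ := mul_le_mul_of_nonneg_left h3 (hW s).le) (by linarith)
  have hn := weight_mul_mul_deriv_nonpos hW hWd hM hN hc₀ hc hQ hK
    (t := S + (1 + |Φ S|) / D) ((le_max_left T t).trans (by linarith))
  have e : D * (S + (1 + |Φ S|) / D - S) = 1 + |Φ S| := by field_simp; ring
  rw [e] at hgrow
  have := neg_abs_le (Φ S)
  linarith

theorem monotone_eq_zero_of_abs_le_energy {W M N q c G : ℝ → ℝ} {T c₀ Q K C : ℝ}
    (hW : ∀ t, 0 < W t) (hWd : ∀ t, HasDerivAt W (q t * W t) t)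
    (hM : ∀ t, HasDerivAt M (N t) t) (hN : ∀ t, HasDerivAt N (c t * M t - q t * N t) t)
    (hc₀ : 0 < c₀) (hc : ∀ t, T ≤ |t| → c₀ ≤ c t) (hQ : ∀ t, |q t| ≤ Q) (hK : ∀ t, |M t| ≤ K)
    (hG : Monotone G) (hC : 0 < C) (hGC : ∀ t, |G t| ≤ C * (W t * (M t ^ 2 + N t ^ 2))) (t : ℝ) :
    G t = 0 := by
  refine le_antisymm (monotone_nonpos_of_le_energy hW hWd hM hN hc₀
    (fun t ht => hc t (ht.trans (le_abs_self t))) hQ hK hG hC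
    (fun t => (le_abs_self _).trans (hGC t)) t) ?_
  have hneg : ∀ {f : ℝ → ℝ} {f' s : ℝ}, HasDerivAt f f' (-s) →
      HasDerivAt (fun s => f (-s)) (-f') s := fun {f f' s} h => by
    exact (h.scomp s (hasDerivAt_neg s)).congr_deriv (by simp)
  have h := monotone_nonpos_of_le_energy (W := fun t => W (-t)) (M := fun t => M (-t))
    (N := fun t => -N (-t)) (q := fun t => -q (-t)) (c := fun t => c (-t))
    (G := fun t => -G (-t)) (T := T) (fun t => hW _)
    (fun t => (hneg (hWd (-t))).congr_deriv (by ring)) (fun t => hneg (hM (-t)))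
    (fun t => (hneg (hN (-t))).neg.congr_deriv (by ring)) hc₀
    (fun t ht => hc (-t) (by rw [abs_neg]; exact ht.trans (le_abs_self t)))
    (fun t => by rw [abs_neg]; exact hQ _) (fun t => hK _)
    (fun s t hst => neg_le_neg (hG (neg_le_neg hst))) hC
    (fun t => (neg_le_abs _).trans ((hGC (-t)).trans_eq (by ring))) (-t)
  simpa using h

/-- Bounded solutions of the linearized equation in logarithmic coordinates vanish, away from the
eigenvalue `(p-1)/p (b-1/p)`. -/
theorem logistic_ode_bounded_eq_zero {b p lam K : ℝ} (hb : 1 < b) (hp : 1 < p) (hlam : 0 < lam)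
    (hne : lam ≠ (p - 1) / p * (b - 1 / p)) {W M N : ℝ → ℝ} (hW : ∀ t, 0 < W t)
    (hWd : ∀ t, HasDerivAt W ((b * (p - 1) - 1 - b * (p - 2) * sigmoid t) * W t) t)
    (hM : ∀ t, HasDerivAt M (N t) t)
    (hN : ∀ t, HasDerivAt N ((lam - b * (1 + b * (p - 1)) * (sigmoid t * (1 - sigmoid t))) * M t
      - (b * (p - 1) - 1 - b * (p - 2) * sigmoid t) * N t) t)
    (hK : ∀ t, |M t| ≤ K) (t : ℝ) : M t = 0 := by
  have hp0 : 0 < p := by linarith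
  set κ := b * (1 + b * (p - 1)) with hκ
  have hκ0 : 0 < κ := by
    have : 0 < b * (p - 1) := mul_pos (by linarith) (by linarith)
    exact mul_pos (by linarith) (by linarith)
  have hs0 := sigmoid_pos
  have hs1 := sigmoid_lt_one
  have hsd := hasDerivAt_sigmoid
  set q : ℝ → ℝ := fun t => b * (p - 1) - 1 - b * (p - 2) * sigmoid t with hq
  have hQ : ∀ t, |q t| ≤ |b * (p - 1) - 1| + |b * (p - 2)| := by
    intro t
    refine (abs_sub _ _).trans (add_le_add_right ?_ _)
    rw [abs_mul, abs_of_pos (hs0 t)]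
    exact mul_le_of_le_one_right (abs_nonneg _) (hs1 t).le
  obtain ⟨T, hT⟩ : ∃ T, ∀ t, T ≤ |t| → lam / 2 ≤ lam - κ * (sigmoid t * (1 - sigmoid t)) := by
    have h1 : ∀ᶠ t in Filter.atTop, lam / 2 ≤ lam - κ * (sigmoid t * (1 - sigmoid t)) := by
      have : Filter.Tendsto (fun t => lam - κ * (sigmoid t * (1 - sigmoid t))) Filter.atTop
          (nhds (lam - κ * (1 * (1 - 1)))) :=
        ((tendsto_sigmoid_atTop.mul (tendsto_sigmoid_atTop.const_sub 1)).const_mul κ).const_sub lam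
      exact (this.eventually_const_lt (by norm_num; linarith)).mono fun _ => le_of_lt
    have h2 : ∀ᶠ t in Filter.atBot, lam / 2 ≤ lam - κ * (sigmoid t * (1 - sigmoid t)) := by
      have : Filter.Tendsto (fun t => lam - κ * (sigmoid t * (1 - sigmoid t))) Filter.atBot
          (nhds (lam - κ * (0 * (1 - 0)))) :=
        ((tendsto_sigmoid_atBot.mul (tendsto_sigmoid_atBot.const_sub 1)).const_mul κ).const_sub lam
      exact (this.eventually_const_lt (by norm_num; linarith)).mono fun _ => le_of_lt
    obtain ⟨T1, hT1⟩ := Filter.eventually_atTop.1 h1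
    obtain ⟨T2, hT2⟩ := Filter.eventually_atBot.1 h2
    refine ⟨max T1 (-T2), fun t ht => ?_⟩
    rcases le_abs'.1 ht with h | h
    · exact hT2 t (by linarith [le_max_right T1 (-T2)])
    · exact hT1 t ((le_max_left _ _).trans h)
  set y : ℝ → ℝ := fun t => 1 / p - b * sigmoid t with hy
  have hyd : ∀ t, HasDerivAt y (-(b * (sigmoid t * (1 - sigmoid t)))) t := fun t =>
    ((hsd t).const_mul b).const_sub (1 / p)
  set n : ℝ → ℝ := fun t => N t - y t * M t with hn
  set ν := (p - 1) / p * (b - 1 / p) - lam with hν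
  have hnd : ∀ t, HasDerivAt n (-ν * M t - (q t + y t) * n t) t := by
    intro t
    refine ((hN t).sub ((hyd t).mul (hM t))).congr_deriv ?_
    simp only [hn, hy, hν, hq, hκ]
    field_simp
    ring
  have hyb : ∀ t, |y t| ≤ 1 + b := fun t => by
    have h1 : 1 / p ≤ 1 := by rw [div_le_one hp0]; exact hp.le
    have h2 : 0 < 1 / p := by positivity
    have h3 : b * sigmoid t ≤ b := mul_le_of_le_one_right (by linarith) (hs1 t).le
    have h4 : 0 < b * sigmoid t := mul_pos (by linarith) (hs0 t)
    rw [abs_le]; constructor <;> simp only [hy] <;> linarith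
  have hnb : ∀ t, n t ^ 2 ≤ (2 + 2 * (1 + b) ^ 2) * (M t ^ 2 + N t ^ 2) := fun t => by
    have h1 : (y t * M t) ^ 2 ≤ (1 + b) ^ 2 * M t ^ 2 := by
      rw [mul_pow]
      exact mul_le_mul_of_nonneg_right (sq_le_sq' (neg_le_of_abs_le (hyb t))
        (le_of_abs_le (hyb t))) (sq_nonneg _)
    have h2 : n t ^ 2 ≤ 2 * N t ^ 2 + 2 * (y t * M t) ^ 2 := by
      simp only [hn]; nlinarith [sq_nonneg (N t + y t * M t)]
    nlinarith [sq_nonneg (N t), sq_nonneg (M t), mul_nonneg (sq_nonneg (1 + b)) (sq_nonneg (N t))]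
  set C₁ := 2 + 2 * (1 + b) ^ 2 with hC₁
  have hC₁0 : 2 ≤ C₁ := by rw [hC₁]; nlinarith [sq_nonneg (1 + b)]
  have hMn : ∀ t, |M t * n t| ≤ (1 + C₁) * (M t ^ 2 + N t ^ 2) := fun t => by
    have h1 : |M t * n t| ≤ M t ^ 2 + n t ^ 2 := by
      rw [abs_le]
      constructor <;> nlinarith [sq_nonneg (M t + n t), sq_nonneg (M t - n t)]
    nlinarith [hnb t, sq_nonneg (N t)]
  have hFd : ∀ t, HasDerivAt (fun t => W t * (M t * n t)) (W t * (n t ^ 2 - ν * M t ^ 2)) t := by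
    intro t
    refine ((hWd t).mul ((hM t).mul (hnd t))).congr_deriv ?_
    simp only [hn, hq, Pi.mul_apply]
    ring
  have hνne : ν ≠ 0 := fun h => hne (by linarith)
  rcases lt_or_gt_of_ne hνne with hneg | hpos
  · have hmono : Monotone fun t => W t * (M t * n t) :=
      monotone_of_deriv_nonneg (fun t => (hFd t).differentiableAt) fun t => by
        rw [(hFd t).deriv]
        have := mul_nonneg (neg_nonneg.2 hneg.le) (sq_nonneg (M t))
        exact mul_nonneg (hW t).le (by nlinarith [sq_nonneg (n t)])
    have hz := monotone_eq_zero_of_abs_le_energy hW hWd hM hN (half_pos hlam) hT hQ hK hmono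
      (by linarith : 0 < 1 + C₁) (fun t => by
        rw [abs_mul, abs_of_pos (hW t)]
        exact (mul_le_mul_of_nonneg_left (hMn t) (hW t).le).trans_eq (by ring))
    have hz' : (fun t => W t * (M t * n t)) = fun _ => 0 := funext hz
    have h0 := hFd t
    rw [hz'] at h0
    have h1 := h0.unique (hasDerivAt_const t 0)
    have h2 := (mul_eq_zero.1 h1).resolve_left (hW t).ne'
    have h3 : 0 ≤ -ν * M t ^ 2 := mul_nonneg (neg_nonneg.2 hneg.le) (sq_nonneg _)
    have h4 : -ν * M t ^ 2 = 0 := le_antisymm (by have := sq_nonneg (n t); linarith) h3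
    simpa [hνne] using h4
  · set z : ℝ → ℝ := fun t => (b - 1 / p) * ((p - 1) - p * sigmoid t) with hz
    have hzd : ∀ t, HasDerivAt z (-((b - 1 / p) * (p * (sigmoid t * (1 - sigmoid t))))) t :=
      fun t => ((((hsd t).const_mul p).const_sub (p - 1)).const_mul (b - 1 / p)).congr_deriv
        (by ring)
    have hzb : ∀ t, |z t| ≤ |b - 1 / p| * ((p - 1) + p) := fun t => by
      simp only [hz, abs_mul]
      refine mul_le_mul_of_nonneg_left ?_ (abs_nonneg _)
      have h1 : p * sigmoid t ≤ p := mul_le_of_le_one_right hp0.le (hs1 t).le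
      have h2 : 0 < p * sigmoid t := mul_pos hp0 (hs0 t)
      rw [abs_le]; constructor <;> linarith
    set Z := |b - 1 / p| * ((p - 1) + p) with hZ
    have hZ0 : 0 ≤ Z := mul_nonneg (abs_nonneg _) (by linarith)
    have hGd : ∀ t, HasDerivAt (fun t => -ν * (W t * (M t * n t)) - W t * (z t * n t ^ 2))
        (W t * ((ν * M t + z t * n t) ^ 2 + lam * n t ^ 2)) t := by
      intro t
      refine (((hFd t).const_mul (-ν)).sub ((hWd t).mul ((hzd t).mul
        ((hnd t).fun_pow 2)))).congr_deriv ?_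
      simp only [hz, hy, hq, Pi.mul_apply]
      have hlam' : lam = (p - 1) / p * (b - 1 / p) - ν := by rw [hν]; ring
      rw [hlam']
      generalize n t = n'
      generalize M t = m
      field_simp
      ring
    have hmono : Monotone fun t => -ν * (W t * (M t * n t)) - W t * (z t * n t ^ 2) :=
      monotone_of_deriv_nonneg (fun t => (hGd t).differentiableAt) fun t => by
        rw [(hGd t).deriv]
        exact mul_nonneg (hW t).le (by positivity)
    have hG0 := monotone_eq_zero_of_abs_le_energy hW hWd hM hN (half_pos hlam) hT hQ hK hmono
      (by positivity : 0 < ν * (1 + C₁) + Z * C₁) (fun t => by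
        have h1 : |-ν * (W t * (M t * n t)) - W t * (z t * n t ^ 2)| ≤
            ν * (W t * |M t * n t|) + W t * (|z t| * n t ^ 2) := by
          refine (abs_sub _ _).trans_eq ?_
          rw [abs_mul, abs_neg, abs_of_pos hpos, abs_mul, abs_of_pos (hW t), abs_mul (W t),
            abs_of_pos (hW t), abs_mul (z t), abs_of_nonneg (sq_nonneg (n t))]
        refine h1.trans ?_
        have h2 := mul_le_mul_of_nonneg_left (hMn t) hpos.le
        have h3 : |z t| * n t ^ 2 ≤ Z * (C₁ * (M t ^ 2 + N t ^ 2)) :=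
          mul_le_mul (hzb t) (hnb t) (sq_nonneg _) hZ0
        calc ν * (W t * |M t * n t|) + W t * (|z t| * n t ^ 2)
            = W t * (ν * |M t * n t| + |z t| * n t ^ 2) := by ring
          _ ≤ W t * (ν * ((1 + C₁) * (M t ^ 2 + N t ^ 2)) + Z * (C₁ * (M t ^ 2 + N t ^ 2))) :=
            mul_le_mul_of_nonneg_left (add_le_add h2 h3) (hW t).le
          _ = _ := by ring)
    have hG0' : (fun t => -ν * (W t * (M t * n t)) - W t * (z t * n t ^ 2)) = fun _ => 0 :=
      funext hG0
    have h0 := hGd t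
    rw [hG0'] at h0
    have h1 := (mul_eq_zero.1 (h0.unique (hasDerivAt_const t 0))).resolve_left (hW t).ne'
    have h2 : 0 ≤ lam * n t ^ 2 := mul_nonneg hlam.le (sq_nonneg _)
    have h3 : lam * n t ^ 2 = 0 :=
      le_antisymm (by have := sq_nonneg (ν * M t + z t * n t); linarith) h2
    have h4 : n t = 0 := by simpa [hlam.ne'] using h3
    have h5 : (ν * M t) ^ 2 = 0 := by simpa [h4] using h1
    simpa [hνne] using h5

end LinearODE

section EnergyBound

variable {E : Type*} [NormedAddCommGroup E] [InnerProductSpace ℝ E] [FiniteDimensional ℝ E]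
  [Nontrivial E] [MeasurableSpace E] [BorelSpace E] {μ : Measure E} [μ.IsAddHaarMeasure]

theorem le_pow_mul_rpow_add {p t r : ℝ} (hp : 1 < p) (ht : 0 ≤ t) (hr : 1 ≤ r) (n : ℕ) :
    t ≤ r ^ n * (t ^ p + 2 ^ (n * (p / (p - 1))) * (1 + r) ^ (-(n * (p / (p - 1))))) := by
  have hr0 : 0 < r := by linarith
  have hpq : p.HolderConjugate (p / (p - 1)) := Real.HolderConjugate.conjExponent hp
  have hrn : 0 < r ^ n := pow_pos hr0 n
  set q := p / (p - 1) with hq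
  have hq1 : 1 < q := hpq.symm.lt
  have hy := Real.young_inequality_of_nonneg ht (inv_nonneg.2 hrn.le) hpq
  have h1 : t ^ p / p ≤ t ^ p := div_le_self (rpow_nonneg ht _) hp.le
  have h2 : ((r ^ n)⁻¹) ^ q / q ≤ ((r ^ n)⁻¹) ^ q :=
    div_le_self (rpow_nonneg (inv_nonneg.2 hrn.le) _) hq1.le
  have h3 : ((r ^ n)⁻¹) ^ q = r ^ (-(n * q)) := by
    rw [inv_rpow hrn.le, ← rpow_natCast, ← rpow_mul hr0.le, rpow_neg hr0.le]
  have h4 : r ^ (-(n * q)) ≤ 2 ^ (n * q) * (1 + r) ^ (-(n * q)) := by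
    have h5 : ((1 + r) / 2) ^ (-(n * q)) = 2 ^ (n * q) * (1 + r) ^ (-(n * q)) := by
      rw [div_rpow (by linarith) (by norm_num), rpow_neg (by norm_num : (0 : ℝ) ≤ 2), div_inv_eq_mul,
        mul_comm]
    rw [← h5]
    exact rpow_le_rpow_of_nonpos (by linarith) (by linarith)
      (neg_nonpos.2 (mul_nonneg (Nat.cast_nonneg n) (by linarith)))
  calc t = r ^ n * (t * (r ^ n)⁻¹) := by field_simp
    _ ≤ _ := mul_le_mul_of_nonneg_left (by linarith) hrn.le

/-- Finite energy makes all spherical moments bounded. -/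
theorem exists_abs_sphereMoment_le {p : ℝ} (hp : 1 < p) (hpN : p < Module.finrank ℝ E) {v : E → ℝ}
    (hvc : Continuous v) (hv : ContDiffOn ℝ 1 v {x | x ≠ 0})
    (henergy : Integrable (fun x => ‖fderiv ℝ v x‖ ^ p) μ) (ξ : E) (k : ℕ) :
    ∃ K, ∀ r, 0 < r → |sphereMoment μ v ξ k r| ≤ K := by
  set n := Module.finrank ℝ E - 1 with hn
  have hn1 : (n : ℝ) = Module.finrank ℝ E - 1 := by
    rw [hn, Nat.cast_sub (Module.finrank_pos), Nat.cast_one]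
  set q := p / (p - 1) with hq
  set g : E → ℝ := fun x => ‖fderiv ℝ v x‖ ^ p + 2 ^ (n * q) * (1 + ‖x‖) ^ (-(n * q)) with hg
  have hgi : Integrable g μ := by
    refine henergy.add ((integrable_one_add_norm ?_).const_mul _)
    rw [hn1, hq, mul_div_assoc', lt_div_iff₀ (by linarith)]
    nlinarith
  obtain ⟨hH, -⟩ := integral_polar μ hgi
  have hdv := hv.continuousOn_fderiv_of_isOpen isOpen_ne_zero le_rfl
  have hne : ∀ (r : ℝ), 0 < r → ∀ ω : Metric.sphere (0 : E) 1, r • (ω : E) ≠ 0 := fun r hr ω =>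
    smul_ne_zero hr.ne' (ne_zero_of_mem_unit_sphere ω)
  have hnorm : ∀ (r : ℝ), 0 < r → ∀ ω : Metric.sphere (0 : E) 1, ‖r • (ω : E)‖ = r := by
    intro r hr ω
    rw [norm_smul, norm_eq_of_mem_sphere, mul_one, norm_of_nonneg hr.le]
  have hinteg : ∀ {F : Metric.sphere (0 : E) 1 → ℝ}, Continuous F → Integrable F μ.toSphere :=
    fun hF => hF.integrable_of_hasCompactSupport (HasCompactSupport.of_compactSpace _)
  set H : ℝ → ℝ := fun r => ‖ξ‖ ^ k * (r ^ n * ∫ ω : Metric.sphere (0 : E) 1, g (r • (ω : E))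
    ∂μ.toSphere) with hHd
  have hHi : IntegrableOn H (Set.Ioi 0) := hH.const_mul _
  have hbound : ∀ r, 1 ≤ r → |sphereMoment μ (radialDeriv v) ξ k r| ≤ H r := by
    intro r hr
    have hr0 : 0 < r := by linarith
    have hdc : Continuous fun ω : Metric.sphere (0 : E) 1 => fderiv ℝ v (r • (ω : E)) :=
      hdv.comp_continuous (by fun_prop) (hne r hr0)
    have hgc : Continuous fun ω : Metric.sphere (0 : E) 1 => g (r • (ω : E)) := by
      simp only [hg, hnorm r hr0]
      exact (hdc.norm.rpow_const fun _ => Or.inr (by linarith)).add continuous_const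
    simp only [hHd]
    rw [← norm_eq_abs, sphereMoment]
    rw [← integral_const_mul, ← integral_const_mul]
    refine norm_integral_le_of_norm_le (hinteg
      (F := fun ω => ‖ξ‖ ^ k * (r ^ n * g (r • (ω : E))))
      (continuous_const.mul (continuous_const.mul hgc))) (Filter.Eventually.of_forall fun ω => ?_)
    rw [norm_mul, mul_comm, norm_pow]
    have h1 : ‖(⟪ξ, (ω : E)⟫ : ℝ)‖ ≤ ‖ξ‖ := by
      simpa [norm_eq_of_mem_sphere] using norm_inner_le_norm (𝕜 := ℝ) ξ (ω : E)
    have h2 : ‖radialDeriv v (r • (ω : E))‖ ≤ ‖fderiv ℝ v (r • (ω : E))‖ := by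
      rw [radialDeriv, norm_div, norm_norm, div_le_iff₀ (norm_pos_iff.2 (hne r hr0 ω))]
      exact ContinuousLinearMap.le_opNorm _ _
    have h3 := le_pow_mul_rpow_add hp (norm_nonneg (fderiv ℝ v (r • (ω : E)))) hr n
    refine mul_le_mul (pow_le_pow_left₀ (norm_nonneg _) h1 k) (h2.trans ?_) (norm_nonneg _)
      (by positivity)
    simpa only [hg, hnorm r hr0] using h3
  have hmc := continuous_sphereMoment (μ := μ) hvc ξ k
  have hmc' := continuousOn_sphereMoment (μ := μ) (continuousOn_radialDeriv hv) ξ k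
  obtain ⟨K₀, hK₀⟩ := (isCompact_Icc (a := (0 : ℝ)) (b := 1)).exists_bound_of_continuousOn
    hmc.continuousOn
  have hH0 : ∀ r ∈ Set.Ioi (0 : ℝ), 0 ≤ H r := by
    intro r hr
    have : 0 < r := hr
    refine mul_nonneg (by positivity) (mul_nonneg (by positivity) (integral_nonneg fun ω => ?_))
    simp only [hg, Pi.zero_apply]
    positivity
  refine ⟨K₀ + ∫ r in Set.Ioi 0, H r, fun r hr => ?_⟩
  have hI0 : 0 ≤ ∫ r in Set.Ioi 0, H r := setIntegral_nonneg measurableSet_Ioi hH0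
  rcases le_total r 1 with h | h
  · have := hK₀ r ⟨hr.le, h⟩
    rw [norm_eq_abs] at this
    linarith
  · have h01 : Set.Ioc 1 r ⊆ Set.Ioi 0 := fun s hs => one_pos.trans hs.1
    have hsub : Set.uIcc 1 r ⊆ Set.Ioi 0 := by
      rw [Set.uIcc_of_le h]; exact fun s hs => lt_of_lt_of_le one_pos hs.1
    have hftc := intervalIntegral.integral_eq_sub_of_hasDerivAt (a := 1) (b := r)
      (f := sphereMoment μ v ξ k) (fun s hs => hasDerivAt_sphereMoment hv ξ k (hsub hs))
      (hmc'.mono hsub).intervalIntegrable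
    have h1 : |∫ s in (1 : ℝ)..r, sphereMoment μ (radialDeriv v) ξ k s| ≤
        ∫ s in (1 : ℝ)..r, H s := by
      refine intervalIntegral.norm_integral_le_of_norm_le
        (f := sphereMoment μ (radialDeriv v) ξ k) (g := H) h
        (Filter.Eventually.of_forall fun s hs => hbound s hs.1.le) ?_
      exact (intervalIntegrable_iff_integrableOn_Ioc_of_le h).2 (hHi.mono_set h01)
    have h2 : ∫ s in (1 : ℝ)..r, H s ≤ ∫ r in Set.Ioi 0, H r := by
      rw [intervalIntegral.integral_of_le h]
      exact setIntegral_mono_set hHi (ae_restrict_of_forall_mem measurableSet_Ioi hH0)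
        (Filter.Eventually.of_forall h01)
    have h3 := hK₀ 1 ⟨zero_le_one, le_rfl⟩
    rw [norm_eq_abs] at h3
    rw [hftc] at h1
    have h4 : sphereMoment μ v ξ k r = (sphereMoment μ v ξ k r - sphereMoment μ v ξ k 1) +
      sphereMoment μ v ξ k 1 := by ring
    rw [h4]
    exact (abs_add_le _ _).trans (by linarith)

end EnergyBound

section LogisticKernel

/-- Two bounded solutions of a second order linear ODE whose fluxes vanish at `-∞` are
proportional. -/
theorem exists_eq_const_mul_of_flux_tendsto_zero {W q c M N Z Y : ℝ → ℝ} {K L : ℝ}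
    (hW : ∀ t, 0 < W t) (hWd : ∀ t, HasDerivAt W (q t * W t) t)
    (hM : ∀ t, HasDerivAt M (N t) t) (hN : ∀ t, HasDerivAt N (c t * M t - q t * N t) t)
    (hZ : ∀ t, HasDerivAt Z (Y t) t) (hY : ∀ t, HasDerivAt Y (c t * Z t - q t * Y t) t)
    (hK : ∀ t, |M t| ≤ K) (hL : ∀ t, |Z t| ≤ L)
    (hN0 : Filter.Tendsto (fun t => W t * N t) Filter.atBot (nhds 0))
    (hY0 : Filter.Tendsto (fun t => W t * Y t) Filter.atBot (nhds 0))
    (hne : ∀ t, Z t ≠ 0 ∨ Y t ≠ 0) : ∃ a, ∀ t, M t = a * Z t := by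
  have hΦ : ∀ t, HasDerivAt (fun t => W t * (N t * Z t - M t * Y t)) 0 t := fun t => by
    refine ((hWd t).mul (((hN t).mul (hZ t)).sub ((hM t).mul (hY t)))).congr_deriv ?_
    simp only [Pi.sub_apply, Pi.mul_apply]
    ring
  have hbdd : ∀ {f : ℝ → ℝ} {B : ℝ}, (∀ t, |f t| ≤ B) →
      Filter.IsBoundedUnder (· ≤ ·) Filter.atBot ((‖·‖) ∘ f) := fun {f B} h =>
    Filter.isBoundedUnder_of ⟨B, fun t => h t⟩
  have hΦ0 : Filter.Tendsto (fun t => W t * (N t * Z t - M t * Y t)) Filter.atBot (nhds 0) := by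
    have h := (hN0.zero_mul_isBoundedUnder_le (hbdd hL)).sub
      (hY0.zero_mul_isBoundedUnder_le (hbdd hK))
    rw [sub_zero] at h
    exact h.congr fun t => by ring
  have hwr : ∀ t, N t * Z t = M t * Y t := by
    intro t
    have hconst := is_const_of_deriv_eq_zero (fun s => (hΦ s).differentiableAt)
      (fun s => (hΦ s).deriv)
    have h0 : W t * (N t * Z t - M t * Y t) = 0 := tendsto_nhds_unique
      (tendsto_const_nhds.congr fun s => hconst t s) hΦ0
    linarith [(mul_eq_zero.1 h0).resolve_left (hW t).ne']
  have hD : ∀ t, Z t ^ 2 + Y t ^ 2 ≠ 0 := fun t h => by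
    have h1 : Z t = 0 := by nlinarith [sq_nonneg (Z t), sq_nonneg (Y t)]
    have h2 : Y t = 0 := by nlinarith [sq_nonneg (Z t), sq_nonneg (Y t)]
    exact (hne t).elim (fun h => h h1) fun h => h h2
  set φ : ℝ → ℝ := fun t => (M t * Z t + N t * Y t) / (Z t ^ 2 + Y t ^ 2) with hφ
  have hMφ : ∀ t, M t = φ t * Z t := fun t => by
    have := hD t
    simp only [hφ]
    field_simp
    linear_combination - Y t * hwr t
  have hNφ : ∀ t, N t = φ t * Y t := fun t => by
    have := hD t
    simp only [hφ]
    field_simp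
    linear_combination Z t * hwr t
  have hφd : ∀ t, HasDerivAt φ 0 t := fun t => by
    refine ((((hM t).mul (hZ t)).add ((hN t).mul (hY t))).div
      (((hZ t).pow 2).add ((hY t).pow 2)) (hD t)).congr_deriv ?_
    simp only [Pi.add_apply, Pi.mul_apply, Pi.pow_apply]
    rw [hMφ t, hNφ t]
    refine div_eq_zero_iff.2 (Or.inl ?_)
    push_cast
    ring
  refine ⟨φ 0, fun t => ?_⟩
  rw [is_const_of_deriv_eq_zero (fun s => (hφd s).differentiableAt) (fun s => (hφd s).deriv) 0 t]
  exact hMφ t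

theorem hasDerivAt_one_add_exp_rpow (s t : ℝ) :
    HasDerivAt (fun t => (1 + exp t) ^ s) (s * (sigmoid t * (1 + exp t) ^ s)) t := by
  have hpos : 0 < 1 + exp t := by positivity
  refine (((hasDerivAt_exp t).const_add 1).rpow_const (p := s) (Or.inl hpos.ne')).congr_deriv ?_
  rw [sigmoid_def, exp_neg, rpow_sub_one hpos.ne']
  field_simp
  ring

theorem sigmoid_eq_exp_div (t : ℝ) : sigmoid t = exp t / (1 + exp t) := by
  rw [sigmoid_def, exp_neg]
  field_simp
  ring

/-- The logarithmic form of the weight `r^(N-1) |U'|^(p-2)`. -/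
def logisticWeight (b p t : ℝ) : ℝ :=
  exp ((b * (p - 1) - 1) * t) * (1 + exp t) ^ (-(b * (p - 2)))

theorem logisticWeight_pos (b p t : ℝ) : 0 < logisticWeight b p t := by
  unfold logisticWeight; positivity

theorem hasDerivAt_logisticWeight (b p t : ℝ) : HasDerivAt (logisticWeight b p)
    ((b * (p - 1) - 1 - b * (p - 2) * sigmoid t) * logisticWeight b p t) t := by
  refine (((hasDerivAt_id t).const_mul (b * (p - 1) - 1)).exp.mul
    (hasDerivAt_one_add_exp_rpow (-(b * (p - 2))) t)).congr_deriv ?_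
  simp only [logisticWeight, id_eq]
  ring

/-- The logarithmic form of the radial kernel element. -/
def logisticKernel (b p t : ℝ) : ℝ := (p - 1 - exp t) * (1 + exp t) ^ (-b)

/-- The derivative of `logisticKernel`. -/
def logisticKernelDeriv (b p t : ℝ) : ℝ :=
  -((exp t + b * (p - 1 - exp t) * sigmoid t) * (1 + exp t) ^ (-b))

theorem hasDerivAt_logisticKernel (b p t : ℝ) :
    HasDerivAt (logisticKernel b p) (logisticKernelDeriv b p t) t := by
  refine (((hasDerivAt_exp t).const_sub (p - 1)).mul
    (hasDerivAt_one_add_exp_rpow (-b) t)).congr_deriv ?_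
  simp only [logisticKernelDeriv]
  ring

theorem hasDerivAt_logisticKernelDeriv (b p t : ℝ) : HasDerivAt (logisticKernelDeriv b p)
    (-(b * (1 + b * (p - 1)) * (sigmoid t * (1 - sigmoid t))) * logisticKernel b p t -
      (b * (p - 1) - 1 - b * (p - 2) * sigmoid t) * logisticKernelDeriv b p t) t := by
  have hs : HasDerivAt sigmoid (sigmoid t * (1 - sigmoid t)) t := hasDerivAt_sigmoid t
  have hpos : 0 < 1 + exp t := by positivity
  refine ((((hasDerivAt_exp t).add ((((hasDerivAt_exp t).const_sub (p - 1)).const_mul b).mul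
    hs)).mul (hasDerivAt_one_add_exp_rpow (-b) t)).neg).congr_deriv ?_
  simp only [logisticKernelDeriv, logisticKernel, Pi.add_apply, Pi.mul_apply]
  rw [sigmoid_eq_exp_div]
  field_simp
  ring

theorem abs_logisticKernel_le {b p : ℝ} (hb : 1 < b) (hp : 1 < p) (t : ℝ) :
    |logisticKernel b p t| ≤ p := by
  have he := exp_pos t
  have hpos : 0 < 1 + exp t := by positivity
  have h1 : |p - 1 - exp t| ≤ p * (1 + exp t) := by
    rw [abs_le]; constructor <;> nlinarith
  have h2 : (1 + exp t) ^ (-b) ≤ (1 + exp t)⁻¹ := by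
    rw [← rpow_neg_one]
    exact rpow_le_rpow_of_exponent_le (by linarith) (by linarith)
  rw [logisticKernel, abs_mul, abs_of_pos (rpow_pos_of_pos hpos _)]
  calc _ ≤ p * (1 + exp t) * (1 + exp t)⁻¹ :=
        mul_le_mul h1 h2 (rpow_nonneg hpos.le _) (by positivity)
    _ = p := by field_simp

theorem logisticKernel_ne_zero_or (b : ℝ) {p : ℝ} (t : ℝ) :
    logisticKernel b p t ≠ 0 ∨ logisticKernelDeriv b p t ≠ 0 := by
  have hpos : (1 + exp t) ^ (-b) ≠ 0 := by positivity
  by_cases h : p - 1 - exp t = 0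
  · right
    rw [logisticKernelDeriv, h]
    simpa using hpos
  · exact Or.inl (mul_ne_zero h hpos)

theorem tendsto_logistic_flux {b p : ℝ} (hb : 1 < b) (hp : 1 < p) :
    Filter.Tendsto (fun t => logisticWeight b p t * logisticKernelDeriv b p t)
      Filter.atBot (nhds 0) := by
  have hs : 0 < b * (p - 1) := mul_pos (by linarith) (by linarith)
  have h0 : Filter.Tendsto (fun t => exp (b * (p - 1) * t)) Filter.atBot (nhds 0) :=
    tendsto_exp_atBot.comp (Filter.tendsto_id.const_mul_atBot hs)
  have h1 : Filter.Tendsto (fun t => 1 + exp t) Filter.atBot (nhds (1 + 0)) :=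
    tendsto_exp_atBot.const_add 1
  have hr : ∀ s : ℝ, Filter.Tendsto (fun t => (1 + exp t) ^ s) Filter.atBot (nhds 1) := fun s => by
    simpa using h1.rpow_const (p := s) (Or.inl (by norm_num))
  have h2 : Filter.Tendsto (fun t => 1 + b * (p - 1 - exp t) / (1 + exp t)) Filter.atBot
      (nhds (1 + b * (p - 1 - 0) / (1 + 0))) :=
    (((tendsto_exp_atBot.const_sub (p - 1)).const_mul b).div h1 (by norm_num)).const_add 1
  have h := ((h0.mul (hr (-(b * (p - 2))))).mul ((h2.mul (hr (-b))))).neg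
  rw [zero_mul, zero_mul, neg_zero] at h
  refine h.congr fun t => ?_
  have e : exp (b * (p - 1) * t) = exp ((b * (p - 1) - 1) * t) * exp t := by
    rw [← exp_add]; ring_nf
  rw [logisticWeight, logisticKernelDeriv, sigmoid_eq_exp_div, e]
  field_simp

end LogisticKernel

section LogarithmicMoments

variable {E : Type*} [NormedAddCommGroup E] [InnerProductSpace ℝ E] [FiniteDimensional ℝ E]
  [MeasurableSpace E] [BorelSpace E] {μ : Measure E} [μ.IsAddHaarMeasure]

theorem hasDerivAt_exp_div (a t : ℝ) :
    HasDerivAt (fun t => exp (t / a)) (exp (t / a) / a) t := by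
  simpa [div_eq_mul_inv] using ((hasDerivAt_id t).div_const a).exp

theorem hasDerivAt_sphereMoment_exp {v : E → ℝ} (hv : ContDiffOn ℝ 1 v {x | x ≠ 0}) (ξ : E)
    (k : ℕ) (a t : ℝ) :
    HasDerivAt (fun t => sphereMoment μ v ξ k (exp (t / a)))
      (sphereMoment μ (radialDeriv v) ξ k (exp (t / a)) * (exp (t / a) / a)) t :=
  HasDerivAt.comp (h₂ := sphereMoment μ v ξ k) (h := fun t => exp (t / a)) t
    (hasDerivAt_sphereMoment hv ξ k (exp_pos _)) (hasDerivAt_exp_div a t)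

variable [Nontrivial E]

/-- In logarithmic variables, the moments of a weak solution satisfy a logistic ODE. -/
theorem IsRadialWeakSolution.hasDerivAt_log_moment {p a b : ℝ} {w V : ℝ → ℝ} {v : E → ℝ}
    (h : IsRadialWeakSolution μ p w V v) (hp : 1 < p) (ha : 0 < a)
    (hw : ContDiffOn ℝ 1 w (Set.Ioi 0)) (hV : ContinuousOn V (Set.Ioi 0))
    (hv : ContDiffOn ℝ 1 v {x | x ≠ 0})
    (hwW : ∀ t, exp (t / a) ^ (Module.finrank ℝ E - 1) * w (exp (t / a)) =
      exp (t / a) * logisticWeight b p t)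
    (hVw : ∀ t, exp (t / a) ^ 2 * V (exp (t / a)) = (p - 1) * a ^ 2 * (b * (1 + b * (p - 1))) *
      (sigmoid t * (1 - sigmoid t)) * w (exp (t / a))) (ξ : E) (k : ℕ) (t : ℝ) :
    HasDerivAt (fun t => sphereMoment μ (radialDeriv v) ξ k (exp (t / a)) * (exp (t / a) / a))
      ((k * ((Module.finrank ℝ E - 1 : ℕ) + k - 1)) / ((p - 1) * a ^ 2) *
          sphereMoment μ v ξ k (exp (t / a)) -
        k * (k - 1) * ‖ξ‖ ^ 2 / ((p - 1) * a ^ 2) * sphereMoment μ v ξ (k - 2) (exp (t / a)) -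
        b * (1 + b * (p - 1)) * (sigmoid t * (1 - sigmoid t)) *
          sphereMoment μ v ξ k (exp (t / a)) -
        (b * (p - 1) - 1 - b * (p - 2) * sigmoid t) *
          (sphereMoment μ (radialDeriv v) ξ k (exp (t / a)) * (exp (t / a) / a))) t := by
  set n := Module.finrank ℝ E - 1
  have hr : ∀ t, 0 < exp (t / a) := fun t => exp_pos _
  have hp0 : p - 1 ≠ 0 := by linarith
  have h1 := ((h.hasDerivAt_moment hp hw hV hv ξ k (hr t)).comp t
    (hasDerivAt_exp_div a t)).div_const a
  have hW := logisticWeight_pos b p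
  have h2 := h1.div (hasDerivAt_logisticWeight b p t) (hW t).ne'
  have e : (fun t => sphereMoment μ (radialDeriv v) ξ k (exp (t / a)) * (exp (t / a) / a)) =
      fun t => (exp (t / a) ^ n * (w (exp (t / a)) *
        sphereMoment μ (radialDeriv v) ξ k (exp (t / a)))) / a / logisticWeight b p t := by
    funext s
    have := (hW s).ne'
    rw [← mul_assoc, hwW]
    field_simp
  rw [e]
  refine h2.congr_deriv ?_
  have hWt := hW t
  have hrt := hr t
  have hwt := hwW t
  have hVt := hVw t
  simp only [Function.comp_apply]
  generalize logisticWeight b p t = W at *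
  generalize exp (t / a) = r at *
  generalize sphereMoment μ v ξ k r = m
  generalize sphereMoment μ v ξ (k - 2) r = m₂
  generalize sphereMoment μ (radialDeriv v) ξ k r = d
  have hw' : w r = r * W / r ^ n := by rw [← hwt]; field_simp
  have hV' : V r = (p - 1) * a ^ 2 * (b * (1 + b * (p - 1))) *
      (sigmoid t * (1 - sigmoid t)) * (r * W / r ^ n) / r ^ 2 := by
    rw [← hw', ← hVt]; field_simp
  rw [hw', hV']
  field_simp
  ring

theorem sphereMoment_one_zero_pos (ξ : E) : 0 < sphereMoment μ (fun _ => 1) ξ 0 1 := by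
  simp only [sphereMoment, pow_zero, mul_one, integral_const, smul_eq_mul]
  have : Nonempty (Metric.sphere (0 : E) 1) :=
    (NormedSpace.sphere_nonempty.2 zero_le_one).to_subtype
  exact measureReal_univ_pos

/-- All moments of a bounded weak solution are multiples of the radial kernel element, unless
the linearization is resonant. -/
theorem IsRadialWeakSolution.exists_sphereMoment_eq {p a b : ℝ} {w V : ℝ → ℝ} {v : E → ℝ}
    (h : IsRadialWeakSolution μ p w V v) (hp : 1 < p) (hpN : p < Module.finrank ℝ E) (ha : 0 < a)
    (hb : 1 < b) (hw : ContDiffOn ℝ 1 w (Set.Ioi 0)) (hV : ContinuousOn V (Set.Ici 0))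
    (hvc : Continuous v) (hv : ContDiffOn ℝ 1 v {x | x ≠ 0})
    (henergy : Integrable (fun x => ‖fderiv ℝ v x‖ ^ p) μ)
    (hwW : ∀ t, exp (t / a) ^ (Module.finrank ℝ E - 1) * w (exp (t / a)) =
      exp (t / a) * logisticWeight b p t)
    (hVw : ∀ t, exp (t / a) ^ 2 * V (exp (t / a)) = (p - 1) * a ^ 2 * (b * (1 + b * (p - 1))) *
      (sigmoid t * (1 - sigmoid t)) * w (exp (t / a)))
    (hne : ∀ k : ℕ, 1 ≤ k → (k * ((Module.finrank ℝ E - 1 : ℕ) + k - 1)) / ((p - 1) * a ^ 2) ≠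
      (p - 1) / p * (b - 1 / p)) :
    ∃ c, ∀ ξ (k : ℕ) t, sphereMoment μ v ξ k (exp (t / a)) =
      c * sphereMoment μ (fun _ => 1) ξ k 1 * logisticKernel b p t := by
  set n := Module.finrank ℝ E - 1 with hn
  have hp0 : 0 < p - 1 := by linarith
  have hn1 : (1 : ℝ) ≤ (n : ℝ) := by
    have h1 : (1 : ℝ) < Module.finrank ℝ E := hp.trans hpN
    have h2 : 1 < Module.finrank ℝ E := by exact_mod_cast h1
    exact_mod_cast (by omega : 1 ≤ n)
  have hM := fun ξ k t => hasDerivAt_sphereMoment_exp (μ := μ) hv ξ k a t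
  have hN := h.hasDerivAt_log_moment hp ha hw (hV.mono Set.Ioi_subset_Ici_self) hv hwW hVw
  have hK := exists_abs_sphereMoment_le (μ := μ) hp hpN hvc hv henergy
  have hzero : ∀ (F : E → ℝ) ξ r, sphereMoment μ F ξ 0 r = sphereMoment μ F 0 0 r := by
    intro F ξ r; simp [sphereMoment]
  obtain ⟨c, hc⟩ : ∃ c, ∀ t, sphereMoment μ v 0 0 (exp (t / a)) = c * logisticKernel b p t := by
    obtain ⟨K, hK⟩ := hK 0 0
    refine exists_eq_const_mul_of_flux_tendsto_zero
      (c := fun t => -(b * (1 + b * (p - 1)) * (sigmoid t * (1 - sigmoid t))))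
      (logisticWeight_pos b p) (hasDerivAt_logisticWeight b p) (hM 0 0) (fun t => ?_)
      (hasDerivAt_logisticKernel b p) (hasDerivAt_logisticKernelDeriv b p)
      (fun t => hK _ (exp_pos _)) (abs_logisticKernel_le hb hp) ?_ (tendsto_logistic_flux hb hp)
      (logisticKernel_ne_zero_or b)
    · refine (hN 0 0 t).congr_deriv ?_
      simp only [Nat.cast_zero]
      ring
    · have h0 := h.tendsto_flux_zero hp hw.continuousOn hV hv hvc 0
      have hr : Filter.Tendsto (fun t => exp (t / a)) Filter.atBot (nhdsWithin 0 (Set.Ioi 0)) :=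
        tendsto_nhdsWithin_iff.2 ⟨tendsto_exp_atBot.comp (Filter.tendsto_id.atBot_div_const ha),
          Filter.Eventually.of_forall fun t => exp_pos _⟩
      have h1 := (h0.comp hr).div_const a
      rw [zero_div] at h1
      refine h1.congr fun t => ?_
      simp only [Function.comp_apply]
      rw [← mul_assoc, hwW]
      field_simp
  set J : E → ℕ → ℝ := fun ξ k => sphereMoment μ (fun _ => 1) ξ k 1 with hJ
  have hJ0 : 0 < J 0 0 := sphereMoment_one_zero_pos 0
  refine ⟨c / J 0 0, fun ξ k => ?_⟩
  set c' := c / J 0 0 with hc'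
  change ∀ t, _ = c' * J ξ k * _
  induction k using Nat.strong_induction_on with
  | _ k ih =>
    rcases Nat.eq_zero_or_pos k with rfl | hk
    · intro t
      rw [hzero, hc, hc', show J ξ 0 = J 0 0 from hzero _ ξ 1]
      have : J 0 0 ≠ 0 := hJ0.ne'
      field_simp
    · have hk1 : (1 : ℝ) ≤ k := by exact_mod_cast hk
      have hrec : k * (n + k - 1) * J ξ k = k * (k - 1) * ‖ξ‖ ^ 2 * J ξ (k - 2) :=
        sphereMoment_one_recursion ξ k
      have hprev : ∀ t, k * (k - 1) * ‖ξ‖ ^ 2 * sphereMoment μ v ξ (k - 2) (exp (t / a)) =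
          k * (k - 1) * ‖ξ‖ ^ 2 * (c' * J ξ (k - 2) * logisticKernel b p t) := fun t => by
        rcases Nat.lt_or_ge k 2 with h2 | h2
        · obtain rfl : k = 1 := by omega
          simp
        · rw [ih (k - 2) (by omega) t]
      obtain ⟨K, hK⟩ := hK ξ k
      intro t
      rw [← sub_eq_zero]
      refine logistic_ode_bounded_eq_zero (lam := k * (n + k - 1) / ((p - 1) * a ^ 2))
        (K := K + |c' * J ξ k| * p) hb hp
        (div_pos (mul_pos (by linarith) (by linarith)) (by positivity)) (hne k hk)
        (logisticWeight_pos b p) (hasDerivAt_logisticWeight b p)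
        (M := fun t => sphereMoment μ v ξ k (exp (t / a)) - c' * J ξ k * logisticKernel b p t)
        (fun t => (hM ξ k t).sub ((hasDerivAt_logisticKernel b p t).const_mul _))
        (fun t => ((hN ξ k t).sub
          ((hasDerivAt_logisticKernelDeriv b p t).const_mul (c' * J ξ k))).congr_deriv ?_)
        (fun t => ?_) t
      · have hp' := hprev t
        field_simp
        linear_combination (-hp') + c' * logisticKernel b p t * hrec
      · refine (abs_sub _ _).trans (add_le_add (hK _ (exp_pos _)) ?_)
        rw [abs_mul]
        exact mul_le_mul_of_nonneg_left (abs_logisticKernel_le hb hp t) (abs_nonneg _)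

end LogarithmicMoments

section SphereDensity

variable {E : Type*} [NormedAddCommGroup E] [InnerProductSpace ℝ E] [FiniteDimensional ℝ E]
  [MeasurableSpace E] [BorelSpace E]

omit [FiniteDimensional ℝ E] [MeasurableSpace E] [BorelSpace E] in
variable (E) in
/-- The exponentials `ω ↦ exp ⟪ξ, ω⟫` on the unit sphere. -/
def sphereExp : Multiplicative E →* C(Metric.sphere (0 : E) 1, ℝ) where
  toFun ξ := ⟨fun ω => exp ⟪ξ.toAdd, (ω : E)⟫, by fun_prop⟩
  map_one' := by ext ω; simp
  map_mul' ξ η := by ext ω; simp [inner_add_left, exp_add]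

theorem hasSum_exp_real (x : ℝ) : HasSum (fun k : ℕ => x ^ k / k.factorial) (exp x) := by
  rw [exp_eq_exp_ℝ]
  exact NormedSpace.expSeries_div_hasSum_exp x

/-- A continuous function on the unit sphere is determined by its moments. -/
theorem eq_zero_of_forall_integral_mul_inner_pow {ν : Measure (Metric.sphere (0 : E) 1)}
    [IsFiniteMeasure ν] [ν.IsOpenPosMeasure] {u : Metric.sphere (0 : E) 1 → ℝ} (hu : Continuous u)
    (h : ∀ (ξ : E) (k : ℕ), ∫ ω, u ω * ⟪ξ, (ω : E)⟫ ^ k ∂ν = 0) (ω : Metric.sphere (0 : E) 1) :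
    u ω = 0 := by
  have hinteg : ∀ {F : Metric.sphere (0 : E) 1 → ℝ}, Continuous F → Integrable F ν :=
    fun hF => hF.integrable_of_hasCompactSupport (HasCompactSupport.of_compactSpace _)
  have hmul : ∀ {F : Metric.sphere (0 : E) 1 → ℝ}, Continuous F →
      Integrable (fun ω => u ω * F ω) ν :=
    fun hF => hinteg (hu.mul hF)
  have hexp : ∀ ξ : E, ∫ ω, u ω * exp ⟪ξ, (ω : E)⟫ ∂ν = 0 := by
    intro ξ
    have hs := hasSum_integral_of_dominated_convergence (μ := ν)
      (F := fun (k : ℕ) ω => u ω * (⟪ξ, (ω : E)⟫ ^ k / k.factorial))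
      (f := fun ω => u ω * exp ⟪ξ, (ω : E)⟫) (fun k ω => ‖u ω‖ * (‖ξ‖ ^ k / k.factorial))
      (fun k => (hinteg (by fun_prop)).aestronglyMeasurable)
      (fun k => Filter.Eventually.of_forall fun ω => ?_)
      (Filter.Eventually.of_forall fun ω => (summable_pow_div_factorial ‖ξ‖).mul_left _)
      ?_ (Filter.Eventually.of_forall fun ω => ?_)
    · refine hs.unique ?_
      convert hasSum_zero with k
      simp_rw [mul_div_assoc', integral_div, h, zero_div]
    · have h1 : ‖(⟪ξ, (ω : E)⟫ : ℝ)‖ ≤ ‖ξ‖ := by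
        simpa [norm_eq_of_mem_sphere] using norm_inner_le_norm (𝕜 := ℝ) ξ (ω : E)
      rw [norm_mul, norm_div, norm_pow, RCLike.norm_natCast]
      gcongr
    · simp_rw [tsum_mul_left]
      exact (hinteg hu.norm).mul_const _
    · exact (hasSum_exp_real ⟪ξ, (ω : E)⟫).mul_left _
  have hadj : ∀ g ∈ Algebra.adjoin ℝ
      (MonoidHom.mrange (sphereExp E) : Set C(Metric.sphere (0 : E) 1, ℝ)),
      ∫ ω, u ω * g ω ∂ν = 0 := by
    intro g hg
    rw [← Subalgebra.mem_toSubmodule, Algebra.adjoin_eq_span, Submonoid.closure_eq] at hg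
    induction hg using Submodule.span_induction with
    | mem g hg =>
      obtain ⟨ξ, rfl⟩ := hg
      exact hexp ξ.toAdd
    | zero => simp
    | add f g _ _ hf hg =>
      simp only [ContinuousMap.add_apply, mul_add]
      rw [integral_add (hmul f.continuous) (hmul g.continuous), hf, hg, add_zero]
    | smul a g _ hg =>
      simp only [ContinuousMap.smul_apply, smul_eq_mul, mul_left_comm _ a]
      rw [integral_const_mul, hg, mul_zero]
  have hsep : (Algebra.adjoin ℝ
      (MonoidHom.mrange (sphereExp E) : Set C(Metric.sphere (0 : E) 1, ℝ))).SeparatesPoints := by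
    intro x y hxy
    refine ⟨_, ⟨sphereExp E (.ofAdd ((x : E) - y)), Algebra.subset_adjoin ⟨_, rfl⟩, rfl⟩, ?_⟩
    intro he
    have h1 : ⟪(x : E) - y, (x : E)⟫ = ⟪(x : E) - y, (y : E)⟫ := exp_injective he
    rw [← sub_eq_zero, ← inner_sub_right, inner_self_eq_zero, sub_eq_zero] at h1
    exact hxy (Subtype.ext h1)
  have hsq : ∫ ω, u ω * u ω ∂ν = 0 := by
    have hb : ∀ ε : ℝ, 0 < ε → |∫ ω, u ω * u ω ∂ν| ≤ ε * ∫ ω, ‖u ω‖ ∂ν := by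
      intro ε hε
      obtain ⟨⟨g, hg⟩, hgε⟩ := ContinuousMap.exists_mem_subalgebra_near_continuous_of_separatesPoints
        _ hsep u hu ε hε
      have e : ∫ ω, u ω * u ω ∂ν = ∫ ω, u ω * (u ω - g ω) ∂ν := by
        simp_rw [mul_sub]
        rw [integral_sub (hmul hu) (hmul g.continuous), hadj g hg, sub_zero]
      rw [e, ← integral_const_mul, ← norm_eq_abs]
      refine norm_integral_le_of_norm_le ((hinteg hu.norm).const_mul ε)
        (Filter.Eventually.of_forall fun ω => ?_)
      rw [norm_mul, mul_comm]
      refine mul_le_mul_of_nonneg_right ?_ (norm_nonneg _)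
      rw [norm_sub_rev]
      exact (hgε ω).le
    have hlim : Filter.Tendsto (fun ε : ℝ => ε * ∫ ω, ‖u ω‖ ∂ν) (nhdsWithin 0 (Set.Ioi 0))
        (nhds (0 * ∫ ω, ‖u ω‖ ∂ν)) :=
      (tendsto_nhdsWithin_of_tendsto_nhds Filter.tendsto_id).mul_const _
    rw [zero_mul] at hlim
    exact abs_nonpos_iff.1 (ge_of_tendsto hlim
      (Filter.eventually_of_mem self_mem_nhdsWithin fun ε hε => hb ε hε))
  have hz := (hu.mul hu).integral_pos_of_hasCompactSupport_nonneg_nonzero (μ := ν) (x := ω)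
    (HasCompactSupport.of_compactSpace _) (fun ω => mul_self_nonneg (u ω))
  by_contra hne
  exact (hz (mul_self_ne_zero.2 hne)).ne' hsq

end SphereDensity

section RadialKernel

variable {E : Type*} [NormedAddCommGroup E] [InnerProductSpace ℝ E] [FiniteDimensional ℝ E]
  [MeasurableSpace E] [BorelSpace E] {μ : Measure E} [μ.IsAddHaarMeasure]

theorem eq_radial_of_sphereMoment_eq {v : E → ℝ} (hvc : Continuous v) {r z : ℝ}
    (h : ∀ ξ (k : ℕ), sphereMoment μ v ξ k r = z * sphereMoment μ (fun _ => 1) ξ k 1)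
    (ω : Metric.sphere (0 : E) 1) : v (r • (ω : E)) = z := by
  have hinteg : ∀ {F : Metric.sphere (0 : E) 1 → ℝ}, Continuous F → Integrable F μ.toSphere :=
    fun hF => hF.integrable_of_hasCompactSupport (HasCompactSupport.of_compactSpace _)
  rw [← sub_eq_zero]
  refine eq_zero_of_forall_integral_mul_inner_pow (ν := μ.toSphere)
    (u := fun ω => v (r • (ω : E)) - z) (by fun_prop) (fun ξ k => ?_) ω
  have h1 := h ξ k
  simp only [sphereMoment, one_mul] at h1
  simp_rw [sub_mul]
  rw [integral_sub (hinteg (by fun_prop)) (hinteg (by fun_prop)), integral_const_mul, h1, sub_self]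

end RadialKernel

section HenonLinearization

theorem eq_alphaK {N p α : ℝ} (hp : 1 < p) (hN : 2 ≤ N) (hα : 0 < α) (k : ℕ)
    (h : (p - 1) * α ^ 2 + p * (N + p - 2) * α = p ^ 2 * ((k - 1) * (k + N - 1))) :
    α = alphaK N p k := by
  have hsq : Real.sqrt ((N + p - 2) ^ 2 + 4 * ((k : ℝ) - 1) * (p - 1) * ((k : ℝ) + N - 1)) =
      (2 * (p - 1) * α + p * (N + p - 2)) / p := by
    rw [Real.sqrt_eq_iff_mul_self_eq_of_pos]
    · field_simp
      linear_combination 4 * (p - 1) * h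
    · have : 0 < (p - 1) * α := mul_pos (by linarith) hα
      have : 0 < p * (N + p - 2) := mul_pos (by linarith) (by linarith)
      exact div_pos (by linarith) (by linarith)
  have hp1 : p - 1 ≠ 0 := by linarith
  rw [alphaK, hsq]
  field_simp
  ring

theorem henon_nonresonant {N p α : ℝ} (hp : 1 < p) (hN : 2 ≤ N) (hα : 0 < α)
    (hαk : ∀ k : ℕ, 2 ≤ k → α ≠ alphaK N p k) (k : ℕ) (hk : 1 ≤ k) :
    k * (N - 1 + k - 1) / ((p - 1) * ((p + α) / (p - 1)) ^ 2) ≠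
      (p - 1) / p * ((N + α) / (p + α) - 1 / p) := by
  intro h
  have hp1 : p - 1 ≠ 0 := by linarith
  have hp0 : p ≠ 0 := by linarith
  have hpα : p + α ≠ 0 := by linarith
  have hq : (p - 1) * α ^ 2 + p * (N + p - 2) * α = p ^ 2 * ((k - 1) * (k + N - 1)) := by
    field_simp at h
    linear_combination -h
  rcases Nat.lt_or_ge k 2 with h2 | h2
  · obtain rfl : k = 1 := by omega
    have h1 : 0 < (p - 1) * α ^ 2 := mul_pos (by linarith) (by positivity)
    have h3 : 0 < p * (N + p - 2) * α := mul_pos (mul_pos (by linarith) (by linarith)) hα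
    simp only [Nat.cast_one, sub_self, zero_mul, mul_zero] at hq
    linarith
  · exact hαk k h2 (eq_alphaK hp hN hα k hq)

theorem Cnpa_pos {N p α : ℝ} (hp : 1 < p) (hpN : p < N) (hα : 0 < α) : 0 < Cnpa N p α :=
  rpow_pos_of_pos (mul_pos (by linarith)
    (rpow_pos_of_pos (div_pos (by linarith) (by linarith)) _)) _

/-- The normalization `C_{N,p,α}` turns the linearized equation into its scale-free form. -/
theorem pS_sub_one_mul_Cnpa_rpow {N p α : ℝ} (hp : 1 < p) (hpN : p < N) (hα : 0 < α) :
    (pS N p α - 1) * Cnpa N p α ^ (pS N p α - 2) =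
      (Cnpa N p α * ((N - p) / (p - 1))) ^ (p - 2) * ((p - 1) * ((p + α) / (p - 1)) ^ 2 *
        ((N + α) / (p + α) * (1 + (N + α) / (p + α) * (p - 1)))) := by
  have hC := Cnpa_pos hp hpN hα
  have hp1 : 0 < p - 1 := by linarith
  have hNp : 0 < N - p := by linarith
  have hpα : 0 < p + α := by linarith
  have hNα : 0 < N + α := by linarith
  have hm : 0 < (N - p) / (p - 1) := div_pos hNp hp1
  have hCp : Cnpa N p α ^ (pS N p α - p) = (N + α) * ((N - p) / (p - 1)) ^ (p - 1) := by
    rw [Cnpa, ← rpow_mul (mul_nonneg hNα.le (rpow_nonneg hm.le _))]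
    have : (N - p) / (p * (p + α)) * (pS N p α - p) = 1 := by
      rw [pS]; field_simp; ring
    rw [this, rpow_one]
  have e1 : Cnpa N p α ^ (pS N p α - 2) =
      Cnpa N p α ^ (pS N p α - p) * Cnpa N p α ^ (p - 2) := by
    rw [← rpow_add hC]; ring_nf
  have e2 : ((N - p) / (p - 1)) ^ (p - 1) =
      ((N - p) / (p - 1)) ^ (p - 2) * ((N - p) / (p - 1)) := by
    rw [← rpow_add_one hm.ne']; ring_nf
  rw [e1, hCp, e2, mul_rpow hC.le hm.le, pS]
  generalize Cnpa N p α ^ (p - 2) = A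
  generalize ((N - p) / (p - 1)) ^ (p - 2) = B
  field_simp
  ring

theorem hasDerivAt_Urad {N p α r : ℝ} (hp : 1 < p) (hα : 0 < α) (hr : 0 < r) :
    HasDerivAt (Urad N p α) (-(Cnpa N p α * ((N - p) / (p - 1)) *
      (r ^ ((p + α) / (p - 1) - 1) *
        (1 + r ^ ((p + α) / (p - 1))) ^ (-((N + α) / (p + α)))))) r := by
  have hD : 0 < 1 + r ^ ((p + α) / (p - 1)) := by positivity
  have hp1 : p - 1 ≠ 0 := by linarith
  have hpα : p + α ≠ 0 := by linarith
  refine ((((Real.hasDerivAt_rpow_const (p := (p + α) / (p - 1)) (Or.inl hr.ne')).const_add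
    1).rpow_const (p := -((N - p) / (p + α))) (Or.inl hD.ne')).const_mul
    (Cnpa N p α)).congr_deriv ?_
  rw [show -((N - p) / (p + α)) - 1 = -((N + α) / (p + α)) by field_simp; ring]
  field_simp

theorem gradient_Ufun {N : ℕ} {p α : ℝ} (hp : 1 < p) (hα : 0 < α)
    {x : EuclideanSpace ℝ (Fin N)} (hx : x ≠ 0) :
    gradient (Ufun N p α) x = (-(Cnpa N p α * ((N - p) / (p - 1)) *
      (‖x‖ ^ ((p + α) / (p - 1) - 1) *
        (1 + ‖x‖ ^ ((p + α) / (p - 1))) ^ (-((N + α) / (p + α))))) * ‖x‖⁻¹) • x := by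
  have hU := hasDerivAt_Urad (N := N) hp hα (norm_pos_iff.2 hx)
  have h := hasFDerivAt_radial (χ := Urad N p α) hx hU.differentiableAt
  rw [hU.deriv] at h
  refine HasGradientAt.gradient (hasGradientAt_iff_hasFDerivAt.2 (h.congr_fderiv ?_))
  ext y
  simp

/-- The integrand of the linearized operator in terms of the radial weight. -/
theorem linearized_integrand_eq {E : Type*} [NormedAddCommGroup E] [InnerProductSpace ℝ E]
    {x g₁ g₂ : E} (hx : x ≠ 0) (p : ℝ) {d : ℝ} (hd : 0 < d) :
    ‖(-d * ‖x‖⁻¹) • x‖ ^ (p - 2) * ⟪g₁, g₂⟫ + (p - 2) * ‖(-d * ‖x‖⁻¹) • x‖ ^ (p - 4) *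
      (⟪(-d * ‖x‖⁻¹) • x, g₁⟫ * ⟪(-d * ‖x‖⁻¹) • x, g₂⟫) =
    d ^ (p - 2) * (⟪g₁, g₂⟫ + (p - 2) * (⟪x, g₁⟫ * ⟪x, g₂⟫ / ‖x‖ ^ 2)) := by
  have hr : 0 < ‖x‖ := norm_pos_iff.2 hx
  have hn : ‖(-d * ‖x‖⁻¹) • x‖ = d := by
    rw [norm_smul, norm_mul, norm_neg, norm_inv, norm_norm, norm_of_nonneg hd.le]
    field_simp
  have he : d ^ (p - 2) = d ^ (p - 4) * d ^ 2 := by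
    rw [← rpow_natCast, ← rpow_add hd]; norm_num; ring_nf
  rw [hn, real_inner_smul_left, real_inner_smul_left, he]
  field_simp

end HenonLinearization

section HenonWeights

/-- The weight `|U'|^(p-2)` up to a constant factor. -/
def henonWeight (a b p r : ℝ) : ℝ := r ^ ((a - 1) * (p - 2)) * (1 + r ^ a) ^ (-(b * (p - 2)))

/-- The potential of the linearized equation, normalized like `henonWeight`. -/
def henonPotential (a b p α r : ℝ) : ℝ :=
  (p - 1) * a ^ 2 * (b * (1 + b * (p - 1))) * (r ^ α * (1 + r ^ a) ^ (-(b * (p - 2)) - 2))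

theorem contDiffOn_henonWeight (a b p : ℝ) : ContDiffOn ℝ 1 (henonWeight a b p) (Set.Ioi 0) := by
  intro r hr
  have hr0 : 0 < r := hr
  have hD : 0 < 1 + r ^ a := by positivity
  exact ((contDiffAt_id.rpow_const_of_ne hr0.ne').mul
    ((contDiffAt_const.add (contDiffAt_id.rpow_const_of_ne hr0.ne')).rpow_const_of_ne
      hD.ne')).contDiffWithinAt

theorem continuousOn_henonPotential {a α : ℝ} (b p : ℝ) (ha : 0 < a) (hα : 0 < α) :
    ContinuousOn (henonPotential a b p α) (Set.Ici 0) := by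
  have h1 : Continuous fun r : ℝ => r ^ α := continuous_id.rpow_const fun _ => Or.inr hα.le
  have h2 : Continuous fun r : ℝ => 1 + r ^ a :=
    continuous_const.add (continuous_id.rpow_const fun _ => Or.inr ha.le)
  refine continuousOn_const.mul (h1.continuousOn.mul (h2.continuousOn.rpow_const fun r hr => ?_))
  have hr0 : 0 ≤ r := hr
  have : 0 < 1 + r ^ a := by positivity
  exact Or.inl this.ne'

theorem exp_div_rpow {a : ℝ} (ha : a ≠ 0) (t : ℝ) : exp (t / a) ^ a = exp t := by
  rw [← exp_mul, div_mul_cancel₀ _ ha]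

theorem exp_pow_mul_henonWeight {a b p : ℝ} {n : ℕ} (ha : a ≠ 0)
    (hn : (n : ℝ) + (a - 1) * (p - 2) = 1 + a * (b * (p - 1) - 1)) (t : ℝ) :
    exp (t / a) ^ n * henonWeight a b p (exp (t / a)) = exp (t / a) * logisticWeight b p t := by
  rw [henonWeight, logisticWeight, exp_div_rpow ha, ← mul_assoc, ← mul_assoc, ← exp_nat_mul,
    ← exp_mul, ← exp_add, ← exp_add]
  congr 2
  field_simp
  linear_combination t * hn

theorem exp_sq_mul_henonPotential {a b p α : ℝ} (ha : a ≠ 0) (hα : (a - 1) * (p - 1) = 1 + α)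
    (t : ℝ) : exp (t / a) ^ 2 * henonPotential a b p α (exp (t / a)) =
      (p - 1) * a ^ 2 * (b * (1 + b * (p - 1))) * (sigmoid t * (1 - sigmoid t)) *
        henonWeight a b p (exp (t / a)) := by
  have hD : 0 < 1 + exp t := by positivity
  have e1 : exp (t / a) ^ 2 * exp (t / a) ^ α = exp t * exp (t / a) ^ ((a - 1) * (p - 2)) := by
    rw [← exp_nat_mul, ← exp_mul, ← exp_mul, ← exp_add, ← exp_add]
    congr 1
    field_simp
    push_cast
    linear_combination -t * hα
  have e2 : (1 + exp t) ^ (-(b * (p - 2)) - 2) =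
      (1 + exp t) ^ (-(b * (p - 2))) / (1 + exp t) ^ 2 := by
    rw [rpow_sub hD, rpow_two]
  rw [henonWeight, henonPotential, exp_div_rpow ha, sigmoid_eq_exp_div, e2]
  generalize exp (t / a) ^ ((a - 1) * (p - 2)) = X at *
  field_simp
  linear_combination (p - 1) * b * (1 + b * (p - 1)) * e1

end HenonWeights

/-- Non-degeneracy of `U_α`: for `α > 0` with `α ≠ α(k)` for every
integer `k ≥ 2`, any finite-energy weak solution `v` of the linearized equation at `U_α`
is a multiple of `Z(x) = ((p-1) - |x|^{(p+α)/(p-1)})(1 + |x|^{(p+α)/(p-1)})^{-(N+α)/(p+α)}`. -/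
theorem stmt_16 (N : ℕ) (hN : 2 ≤ N) (p α : ℝ) (hp1 : 1 < p) (hpN : p < N) (hα : 0 < α)
    (hαk : ∀ k : ℕ, 2 ≤ k → α ≠ alphaK N p k)
    (v : EuclideanSpace ℝ (Fin N) → ℝ)
    (hcontv : Continuous v) (hC1v : ContDiffOn ℝ 1 v {x | x ≠ 0})
    (henergy : Integrable (fun x : EuclideanSpace ℝ (Fin N) => ‖gradient v x‖ ^ p))
    (hweak : ∀ φ : EuclideanSpace ℝ (Fin N) → ℝ, ContDiff ℝ (⊤ : ℕ∞) φ → HasCompactSupport φ →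
      Integrable (fun x =>
        ‖gradient (Ufun N p α) x‖ ^ (p - 2) * ⟪gradient v x, gradient φ x⟫ +
        (p - 2) * ‖gradient (Ufun N p α) x‖ ^ (p - 4) *
          (⟪gradient (Ufun N p α) x, gradient v x⟫ *
            ⟪gradient (Ufun N p α) x, gradient φ x⟫)) ∧
      Integrable (fun x : EuclideanSpace ℝ (Fin N) =>
        ‖x‖ ^ α * (Ufun N p α x) ^ (pS N p α - 2) * v x * φ x) ∧
      (∫ x, (‖gradient (Ufun N p α) x‖ ^ (p - 2) * ⟪gradient v x, gradient φ x⟫ +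
          (p - 2) * ‖gradient (Ufun N p α) x‖ ^ (p - 4) *
            (⟪gradient (Ufun N p α) x, gradient v x⟫ *
              ⟪gradient (Ufun N p α) x, gradient φ x⟫))) =
        (pS N p α - 1) * ∫ x : EuclideanSpace ℝ (Fin N),
          ‖x‖ ^ α * (Ufun N p α x) ^ (pS N p α - 2) * v x * φ x) :
    ∃ c : ℝ, ∀ x : EuclideanSpace ℝ (Fin N),
      v x = c * ((p - 1) - ‖x‖ ^ ((p + α) / (p - 1))) *
        (1 + ‖x‖ ^ ((p + α) / (p - 1))) ^ (-(((N : ℝ) + α) / (p + α))) := by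
  have hp0 : 0 < p - 1 := by linarith
  have hpα : 0 < p + α := by linarith
  have hNp : 0 < (N : ℝ) - p := by linarith
  have hN2 : (2 : ℝ) ≤ N := by exact_mod_cast hN
  have hfin : Module.finrank ℝ (EuclideanSpace ℝ (Fin N)) = N := finrank_euclideanSpace_fin
  have : Nontrivial (EuclideanSpace ℝ (Fin N)) :=
    Module.nontrivial_of_finrank_pos (R := ℝ) (by omega)
  have hcast : ((N - 1 : ℕ) : ℝ) = N - 1 := by rw [Nat.cast_sub (by omega), Nat.cast_one]
  set a := (p + α) / (p - 1) with ha_def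
  set b := ((N : ℝ) + α) / (p + α) with hb_def
  have ha : 0 < a := div_pos hpα hp0
  have hb : 1 < b := by rw [hb_def, one_lt_div hpα]; linarith
  have haα : (a - 1) * (p - 1) = 1 + α := by rw [ha_def]; field_simp; ring
  have hK : 0 < Cnpa N p α * ((N - p) / (p - 1)) :=
    mul_pos (Cnpa_pos hp1 hpN hα) (div_pos hNp hp0)
  obtain ⟨K, hK_def⟩ : ∃ K, K = Cnpa N p α * ((N - p) / (p - 1)) := ⟨_, rfl⟩
  rw [← hK_def] at hK
  have hsol : IsRadialWeakSolution volume p (henonWeight a b p) (henonPotential a b p α) v := by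
    intro φ hφ hφc
    obtain ⟨-, -, heq⟩ := hweak φ hφ hφc
    have hKp : K ^ (p - 2) ≠ 0 := (rpow_pos_of_pos hK _).ne'
    refine mul_left_cancel₀ hKp ?_
    rw [← integral_const_mul, ← integral_const_mul]
    rw [← integral_const_mul] at heq
    have hae : ∀ᵐ x : EuclideanSpace ℝ (Fin N), x ≠ 0 := by
      simp [ae_iff]
    refine Eq.trans (integral_congr_ae ?_) (heq.trans (integral_congr_ae ?_))
    · filter_upwards [hae] with x hx
      have hr : 0 < ‖x‖ := norm_pos_iff.2 hx
      have hD : 0 < 1 + ‖x‖ ^ a := by positivity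
      have hd : 0 < K * (‖x‖ ^ (a - 1) * (1 + ‖x‖ ^ a) ^ (-b)) := by positivity
      rw [gradient_Ufun hp1 hα hx, ← hK_def, linearized_integrand_eq hx p hd, ← mul_assoc]
      congr 1
      rw [henonWeight, mul_rpow hK.le (by positivity), mul_rpow (by positivity) (by positivity),
        ← rpow_mul hr.le, ← rpow_mul hD.le, neg_mul]
    · refine Filter.Eventually.of_forall fun x => ?_
      have hD : 0 < 1 + ‖x‖ ^ a := by positivity
      have hC := Cnpa_pos hp1 hpN hα
      have hb1 : -((N - p) / (p + α)) * (pS N p α - 2) = -(b * (p - 2)) - 2 := by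
        rw [pS, hb_def]; field_simp; ring
      have hU : Ufun N p α x ^ (pS N p α - 2) =
          Cnpa N p α ^ (pS N p α - 2) * (1 + ‖x‖ ^ a) ^ (-(b * (p - 2)) - 2) := by
        rw [Ufun, Urad, mul_rpow hC.le (rpow_nonneg hD.le _), ← rpow_mul hD.le, hb1]
      have hconst := pS_sub_one_mul_Cnpa_rpow hp1 hpN hα
      rw [← hK_def] at hconst
      simp only [henonPotential]
      rw [hU]
      linear_combination (‖x‖ ^ α * (1 + ‖x‖ ^ a) ^ (-(b * (p - 2)) - 2) * (v x * φ x)) * hconst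
  have hnorm : ∀ x, ‖gradient v x‖ = ‖fderiv ℝ v x‖ := fun x => by
    rw [gradient, LinearIsometryEquiv.norm_map]
  simp only [hnorm] at henergy
  obtain ⟨c, hc⟩ := hsol.exists_sphereMoment_eq hp1 (by rwa [hfin]) ha hb
    (contDiffOn_henonWeight a b p) (continuousOn_henonPotential b p ha hα) hcontv hC1v henergy
    (exp_pow_mul_henonWeight ha.ne' (by
      rw [hfin, hcast, ha_def, hb_def]; field_simp; ring))
    (exp_sq_mul_henonPotential ha.ne' haα) (fun k hk => by
      rw [hfin, hcast]
      exact henon_nonresonant hp1 hN2 hα hαk k hk)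
  refine ⟨c, fun x => ?_⟩
  have hx0 : ∀ x : EuclideanSpace ℝ (Fin N), x ≠ 0 →
      v x = c * ((p - 1) - ‖x‖ ^ a) * (1 + ‖x‖ ^ a) ^ (-b) := by
    intro x hx
    have hr : 0 < ‖x‖ := norm_pos_iff.2 hx
    have hra : exp (a * log ‖x‖ / a) = ‖x‖ := by
      rw [mul_div_cancel_left₀ _ ha.ne', exp_log hr]
    have h := eq_radial_of_sphereMoment_eq hcontv (r := ‖x‖)
      (z := c * logisticKernel b p (a * log ‖x‖)) (fun ξ k => by
        rw [← hra, hc ξ k, hra]; ring)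
      ⟨‖x‖⁻¹ • x, by rw [mem_sphere_zero_iff_norm, norm_smul, norm_inv, norm_norm,
        inv_mul_cancel₀ hr.ne']⟩
    rw [smul_inv_smul₀ hr.ne', logisticKernel, mul_comm a, ← rpow_def_of_pos hr] at h
    rw [h, mul_assoc]
  have hra : Continuous fun x : EuclideanSpace ℝ (Fin N) => ‖x‖ ^ a :=
    continuous_norm.rpow_const fun _ => Or.inr ha.le
  refine congrFun (hcontv.ext_on (dense_compl_singleton 0) ?_ hx0) x
  refine (continuous_const.mul (continuous_const.sub hra)).mul
    ((continuous_const.add hra).rpow_const fun x => Or.inl ?_)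
  have : 0 < 1 + ‖x‖ ^ a := by positivity
  exact this.ne'
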